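/- arXiv:math/0307312 — 2 statements merged into one kernel-verified Lean document; each statement's English description precedes it below -/
import Mathlib

section
/- Let E be an infinite-dimensional Banach space, n ≥ 1, and p > 1. Then there exists a continuous n-homogeneous polynomial P : E → E which is not almost p-summing at every point of E. Explicitly, for any nonzero continuous linear functional φ on E, the polynomial P(x) = φ(x)^{n-1} x fails to be almost p-summing everywhere. -/
open MeasureTheory Filter Finset

/-- The weak ℓ_q norm of a finite family: `sup_{‖φ‖≤1} (∑ |φ x_j|^q)^{1/q}`. -/
noncomputable def weakNorm {E : Type*} [NormedAddCommGroup E] [NormedSpace ℝ E]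
    (q : ℝ) {k : ℕ} (x : Fin k → E) : ℝ :=
  sSup {s : ℝ | ∃ φ : E →L[ℝ] ℝ, ‖φ‖ ≤ 1 ∧ s = (∑ j, |φ (x j)| ^ q) ^ (1 / q)}

/-- The weak ℓ_q norm of a sequence. -/
noncomputable def weakNormSeq {E : Type*} [NormedAddCommGroup E] [NormedSpace ℝ E]
    (q : ℝ) (x : ℕ → E) : ℝ :=
  sSup {s : ℝ | ∃ φ : E →L[ℝ] ℝ, ‖φ‖ ≤ 1 ∧ s = (∑' j, |φ (x j)| ^ q) ^ (1 / q)}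

/-- Unconditionally q-summable sequences: weakly q-summable with weak norms of tails → 0. -/
def UncondSummable {E : Type*} [NormedAddCommGroup E] [NormedSpace ℝ E]
    (q : ℝ) (x : ℕ → E) : Prop :=
  (∀ φ : E →L[ℝ] ℝ, Summable fun j => |φ (x j)| ^ q) ∧
    Tendsto (fun m => weakNormSeq q fun j => x (j + m)) atTop (nhds 0)

/-- The Rademacher functions on [0,1]. -/
noncomputable def rademacher (j : ℕ) (t : ℝ) : ℝ :=
  if Int.fract ((2 : ℝ) ^ j * t) < 1 / 2 then 1 else -1

/-- `(∫_0^1 ‖∑_j r_j(t) y_j‖² dt)^{1/2}` for a finite family `y` in `F`. -/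
noncomputable def radNorm {F : Type*} [NormedAddCommGroup F] [NormedSpace ℝ F]
    {k : ℕ} (y : Fin k → F) : ℝ :=
  (∫ t in (0:ℝ)..1, ‖∑ j : Fin k, rademacher (j : ℕ) t • y j‖ ^ 2) ^ ((1:ℝ) / 2)

/-- `f` is almost p-summing at `a`. -/
def AlmostSummingAt {E F : Type*} [NormedAddCommGroup E] [NormedSpace ℝ E]
    [NormedAddCommGroup F] [NormedSpace ℝ F] (p : ℝ) (f : E → F) (a : E) : Prop :=
  ∃ C > 0, ∃ ε > 0, ∃ r > 0, ∀ (k : ℕ) (x : Fin k → E), weakNorm p x < ε →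
    radNorm (fun j => f (a + x j) - f a) ≤ C * weakNorm p x ^ r

/-- `f` is absolutely (p,q)-summing at `a`. -/
def AbsSummingAt {E F : Type*} [NormedAddCommGroup E] [NormedSpace ℝ E]
    [NormedAddCommGroup F] [NormedSpace ℝ F] (p q : ℝ) (f : E → F) (a : E) : Prop :=
  ∃ M > 0, ∃ δ > 0, ∃ r > 0, ∀ (k : ℕ) (x : Fin k → E), weakNorm q x < δ →
    (∑ j, ‖f (a + x j) - f a‖ ^ p) ≤ M * weakNorm q x ^ r


/-! ### Rademacher averages as finite averages -/

section Signs

open scoped BigOperators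

/-- real value of a sign -/
def sg (u : ℤˣ) : ℝ := ((u : ℤ) : ℝ)

lemma sg_one : sg 1 = 1 := by simp [sg]
lemma sg_neg_one : sg (-1) = -1 := by simp [sg]
lemma sg_mul (u v : ℤˣ) : sg (u * v) = sg u * sg v := by simp [sg]
lemma sg_mul_self (u : ℤˣ) : sg u * sg u = 1 := by
  rcases Int.units_eq_one_or u with h | h <;> simp [h, sg]
lemma sg_abs (u : ℤˣ) : |sg u| = 1 := by
  rcases Int.units_eq_one_or u with h | h <;> simp [h, sg]
lemma sg_neg (u : ℤˣ) : sg (-u) = - sg u := by simp [sg]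

lemma expect_sign (f : ℤˣ → ℝ) : 𝔼 u, f u = (f 1 + f (-1)) / 2 := by
  rw [Fintype.expect_eq_sum_div_card, UnitsInt.univ, Finset.sum_pair (by decide)]
  simp

variable {F : Type*} [NormedAddCommGroup F] [NormedSpace ℝ F]

/-- signed sum -/
def ssum {ι : Type*} [Fintype ι] (x : ι → F) (e : ι → ℤˣ) : F := ∑ i, sg (e i) • x i

lemma expect_cons {n : ℕ} {α : Type*} [Fintype α] (f : (Fin (n + 1) → α) → ℝ) :
    𝔼 e, f e = 𝔼 u : α, 𝔼 e : Fin n → α, f (Fin.cons u e) := by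
  rw [← Finset.expect_product' (s := univ) (t := univ) (f := fun u e => f (Fin.cons u e))]
  rw [Finset.univ_product_univ]
  exact (Fintype.expect_equiv (Fin.consEquiv fun _ => α) _ _ (fun _ => rfl)).symm

lemma ssum_cons {n : ℕ} (x : Fin (n + 1) → F) (u : ℤˣ) (e : Fin n → ℤˣ) :
    ssum x (Fin.cons u e) = sg u • x 0 + ssum (fun i => x i.succ) e := by
  simp [ssum, Fin.sum_univ_succ]

lemma ssum_equiv {ι κ : Type*} [Fintype ι] [Fintype κ] (g : κ ≃ ι) (x : ι → F) (e : ι → ℤˣ) :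
    ssum (fun k => x (g k)) (fun k => e (g k)) = ssum x e := by
  unfold ssum
  exact Equiv.sum_comp g (fun i => sg (e i) • x i)

lemma expect_ssum_equiv {ι κ : Type*} [Fintype ι] [Fintype κ] [DecidableEq ι] [DecidableEq κ]
    (g : κ ≃ ι) (x : ι → F) (h : F → ℝ) :
    𝔼 e : κ → ℤˣ, h (ssum (fun k => x (g k)) e) = 𝔼 e : ι → ℤˣ, h (ssum x e) := by
  symm
  refine Fintype.expect_equiv (Equiv.arrowCongr g.symm (Equiv.refl _)) _ _ (fun e => ?_)
  rw [← ssum_equiv g]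
  rfl

lemma one_step (a x : F) :
    𝔼 u : ℤˣ, ‖a + ((1:ℝ)/2) • sg u • x‖ ^ 4 ≤ (𝔼 u : ℤˣ, ‖a + sg u • x‖ ^ 2) ^ 2 := by
  rw [expect_sign, expect_sign]
  simp only [sg_one, sg_neg_one, one_smul]
  set P := ‖a + x‖
  set Q := ‖a + (-1:ℝ) • x‖
  have h1 : ‖a + ((1:ℝ)/2) • x‖ ≤ (3/4) * P + (1/4) * Q := by
    have : a + ((1:ℝ)/2) • x = (3/4:ℝ) • (a + x) + (1/4:ℝ) • (a + (-1:ℝ) • x) := by module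
    rw [this]
    refine (norm_add_le _ _).trans (le_of_eq ?_)
    rw [norm_smul, norm_smul]; norm_num [P, Q]
  have h2 : ‖a + ((1:ℝ)/2) • (-1:ℝ) • x‖ ≤ (1/4) * P + (3/4) * Q := by
    have : a + ((1:ℝ)/2) • (-1:ℝ) • x = (1/4:ℝ) • (a + x) + (3/4:ℝ) • (a + (-1:ℝ) • x) := by
      module
    rw [this]
    refine (norm_add_le _ _).trans (le_of_eq ?_)
    rw [norm_smul, norm_smul]; norm_num [P, Q]
  have hP : 0 ≤ P := norm_nonneg _
  have hQ : 0 ≤ Q := norm_nonneg _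
  have h1' := pow_le_pow_left₀ (norm_nonneg _) h1 4
  have h2' := pow_le_pow_left₀ (norm_nonneg _) h2 4
  have : (((3/4) * P + (1/4) * Q)^4 + ((1/4) * P + (3/4) * Q)^4) / 2 ≤ ((P^2+Q^2)/2)^2 := by
    obtain ⟨G, hG⟩ : ∃ G, G = (P + Q) / 2 := ⟨_, rfl⟩
    obtain ⟨H, hH⟩ : ∃ H, H = (P - Q) / 2 := ⟨_, rfl⟩
    have e1 : P = G + H := by rw [hG, hH]; ring
    have e2 : Q = G - H := by rw [hG, hH]; ring
    rw [e1, e2]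
    nlinarith [sq_nonneg (G * H), sq_nonneg (H^2)]
  linarith

lemma hyper_fin {n : ℕ} : ∀ (a : F) (x : Fin n → F),
    𝔼 e : Fin n → ℤˣ, ‖a + ((1:ℝ)/2) • ssum x e‖ ^ 4 ≤
      (𝔼 e : Fin n → ℤˣ, ‖a + ssum x e‖ ^ 2) ^ 2 := by
  induction n with
  | zero => intro a x; simp [ssum]; apply le_of_eq; ring
  | succ n ih =>
    intro a x
    rw [expect_cons, expect_cons]
    simp only [ssum_cons]
    set x' : Fin n → F := fun i => x i.succ
    set q : ℤˣ → (Fin n → ℤˣ) → ℝ := fun u e => ‖a + ((1:ℝ)/2) • sg u • x 0 + ssum x' e‖ ^ 2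
    set B : (Fin n → ℤˣ) → ℝ := fun e => 𝔼 u : ℤˣ, ‖a + ssum x' e + sg u • x 0‖ ^ 2
    have hB : ∀ e, 0 ≤ B e := fun e => Finset.expect_nonneg fun _ _ => by positivity
    calc _ ≤ 𝔼 u : ℤˣ, (𝔼 e : Fin n → ℤˣ, q u e) ^ 2 := by
          refine Finset.expect_le_expect fun u _ => ?_
          have := ih (a + ((1:ℝ)/2) • sg u • x 0) x'
          simpa [q, smul_add, add_assoc] using this
      _ = 𝔼 e : Fin n → ℤˣ, 𝔼 e' : Fin n → ℤˣ, 𝔼 u : ℤˣ, q u e * q u e' := by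
          simp only [sq, Finset.expect_mul_expect]
          rw [Finset.expect_comm]
          refine Finset.expect_congr rfl fun e _ => ?_
          rw [Finset.expect_comm]
      _ ≤ 𝔼 e : Fin n → ℤˣ, 𝔼 e' : Fin n → ℤˣ, B e * B e' := by
          refine Finset.expect_le_expect fun e _ => Finset.expect_le_expect fun e' _ => ?_
          refine abs_le_of_sq_le_sq' ?_ (mul_nonneg (hB e) (hB e')) |>.2
          refine (Finset.expect_mul_sq_le_sq_mul_sq _ _ _).trans ?_
          rw [mul_pow]
          have key : ∀ e, 𝔼 u : ℤˣ, q u e ^ 2 ≤ B e ^ 2 := by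
            intro e
            have := one_step (a + ssum x' e) (x 0)
            refine le_trans (le_of_eq ?_) this
            refine Finset.expect_congr rfl fun u _ => ?_
            simp only [q]
            rw [← pow_mul]
            congr 2; abel
          exact mul_le_mul (key e) (key e') (Finset.expect_nonneg fun _ _ => by positivity)
            (by positivity)
      _ = _ := by
          simp only [sq]
          rw [← Finset.expect_mul_expect]
          have : 𝔼 i, B i = 𝔼 u : ℤˣ, 𝔼 e : Fin n → ℤˣ, ‖a + (sg u • x 0 + ssum x' e)‖ * ‖a + (sg u • x 0 + ssum x' e)‖ := by
            rw [Finset.expect_comm]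
            refine Finset.expect_congr rfl fun u _ => Finset.expect_congr rfl fun e _ => ?_
            rw [sq, show a + ssum x' e + sg u • x 0 = a + (sg u • x 0 + ssum x' e) by abel]
          rw [this]

lemma hyper {ι : Type*} [Fintype ι] [DecidableEq ι] (x : ι → F) :
    𝔼 e : ι → ℤˣ, ‖ssum x e‖ ^ 4 ≤ 16 * (𝔼 e : ι → ℤˣ, ‖ssum x e‖ ^ 2) ^ 2 := by
  have h := hyper_fin 0 (fun k => x ((Fintype.equivFin ι).symm k))
  simp only [zero_add, norm_smul, mul_pow] at h
  rw [← Finset.mul_expect, expect_ssum_equiv (h := fun y => ‖y‖ ^ 4),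
    expect_ssum_equiv (h := fun y => ‖y‖ ^ 2)] at h
  norm_num at h
  linarith

/-- L1-L2 comparison from fourth moments. -/
lemma l1_l2 {Ω : Type*} [Fintype Ω] (X : Ω → ℝ) (hX : ∀ w, 0 ≤ X w) (s : ℝ) (hs : 0 ≤ s)
    (h2 : 𝔼 w, X w ^ 2 = s ^ 2) (h4 : 𝔼 w, X w ^ 4 ≤ 16 * (s ^ 2) ^ 2) :
    s / 8 ≤ 𝔼 w, X w := by
  rcases hs.eq_or_lt with h | hs
  · rw [← h]; simpa using Finset.expect_nonneg fun w _ => hX w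
  have hpt : ∀ w, (1 / (4 * s)) * X w ^ 2 - (4/27) * (1 / (4 * s)) ^ 3 * X w ^ 4 ≤ X w := by
    intro w
    obtain ⟨v, hv⟩ : ∃ v, v = X w / (4 * s) := ⟨_, rfl⟩
    have hv0 : 0 ≤ v := by rw [hv]; exact div_nonneg (hX w) (by positivity)
    have e : X w = v * (4 * s) := by rw [hv]; field_simp
    rw [e]
    have : (1 / (4 * s)) * (v * (4 * s)) ^ 2 - (4/27) * (1 / (4 * s)) ^ 3 * (v * (4 * s)) ^ 4
      = (v ^ 2 - (4/27) * v ^ 4) * (4 * s) := by field_simp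
    rw [this]
    refine mul_le_mul_of_nonneg_right ?_ (by positivity)
    have : v - 4/27 * v^3 ≤ 1 := by nlinarith [mul_nonneg (sq_nonneg (2 * v - 3)) (by linarith : 0 ≤ v + 3)]
    nlinarith
  have := Finset.expect_le_expect (s := univ) fun w _ => hpt w
  rw [Finset.expect_sub_distrib, ← Finset.mul_expect, ← Finset.mul_expect, h2] at this
  refine le_trans ?_ this
  have h4' : (4/27) * (1 / (4 * s)) ^ 3 * (𝔼 w, X w ^ 4) ≤ (4/27) * (1 / (4 * s)) ^ 3 * (16 * (s ^ 2) ^ 2) :=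
    mul_le_mul_of_nonneg_left h4 (by positivity)
  have e : (4/27) * (1 / (4 * s)) ^ 3 * (16 * (s ^ 2) ^ 2) = s / 27 := by field_simp; norm_num
  have e2 : 1 / (4 * s) * s ^ 2 = s / 4 := by field_simp
  rw [e2]; rw [e] at h4'; linarith

lemma fourth_le {ι : Type*} [Fintype ι] [DecidableEq ι] (x : ι → F) :
    𝔼 e : ι → ℤˣ, ‖ssum x e‖ ^ 4 ≤ 65536 * (𝔼 e : ι → ℤˣ, ‖ssum x e‖) ^ 4 := by
  set s := Real.sqrt (𝔼 e : ι → ℤˣ, ‖ssum x e‖ ^ 2)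
  have hs : s ^ 2 = 𝔼 e : ι → ℤˣ, ‖ssum x e‖ ^ 2 :=
    Real.sq_sqrt (Finset.expect_nonneg fun _ _ => by positivity)
  have h := hyper x
  rw [← hs] at h
  have h1 := l1_l2 (fun e => ‖ssum x e‖) (fun _ => norm_nonneg _) s (Real.sqrt_nonneg _) hs.symm h
  have h2 := pow_le_pow_left₀ (by positivity) h1 4
  refine h.trans ?_
  nlinarith

/-- orthogonality -/
lemma expect_sq {ι : Type*} [Fintype ι] [DecidableEq ι] (x : ι → ℝ) :
    𝔼 e : ι → ℤˣ, (ssum x e) ^ 2 = ∑ i, x i ^ 2 := by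
  have hf : ∀ {n : ℕ} (a : ℝ) (x : Fin n → ℝ),
      𝔼 e : Fin n → ℤˣ, (a + ssum x e) ^ 2 = a ^ 2 + ∑ i, x i ^ 2 := by
    intro n
    induction n with
    | zero => intro a x; simp [ssum]
    | succ n ih =>
      intro a x
      rw [expect_cons]
      simp only [ssum_cons, ← add_assoc, ih]
      rw [expect_sign, Fin.sum_univ_succ]
      simp [sg]; ring
  rw [← expect_ssum_equiv (Fintype.equivFin ι).symm x (fun y => y ^ 2)]
  have := hf 0 (fun k => x ((Fintype.equivFin ι).symm k))
  simp only [zero_add] at this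
  rw [this]
  simpa using Equiv.sum_comp (Fintype.equivFin ι).symm (fun i => x i ^ 2)

end Signs

/-! ### Decoupling -/

section Decouple

open scoped BigOperators

variable {F : Type*} [NormedAddCommGroup F] [NormedSpace ℝ F]

lemma decouple_one {T Ω : Type*} [Nonempty T] [Fintype Ω] [Nonempty Ω]
    (L : T → F →ₗ[ℝ] ℝ) (hL : ∀ t z, |L t z| ≤ ‖z‖) (y : Ω → F) (nu : Ω ≃ Ω)
    (hnu : ∀ w, y (nu w) = - y w) (b : ℝ) (hb : ∀ t, 𝔼 w, |L t (y w)| ≤ b)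
    (a : T → ℝ) (A : ℝ) (ha : ∀ t, a t ≤ A) :
    𝔼 w, ⨆ t, (a t + |L t (y w)|) ≤ b + 𝔼 w, ⨆ t, (a t + 2 * L t (y w)) := by
  set g : F → ℝ := fun z => ⨆ t, (a t + 2 * L t z) with hg
  have hgle : ∀ t z, a t + 2 * L t z ≤ g z := by
    intro t z
    refine le_ciSup (f := fun t => a t + 2 * L t z) ⟨A + 2 * ‖z‖, ?_⟩ t
    rintro _ ⟨t, rfl⟩
    have := le_of_abs_le (hL t z)
    have := ha t
    simp only; linarith
  set h : Ω → Ω → ℝ := fun w w' => ⨆ t, (a t + |L t (y w)| - |L t (y w')|) with hh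
  have hhle : ∀ w w' t, a t + |L t (y w)| - |L t (y w')| ≤ h w w' := by
    intro w w' t
    refine le_ciSup (f := fun t => a t + |L t (y w)| - |L t (y w')|) ⟨A + ‖y w‖, ?_⟩ t
    rintro _ ⟨t, rfl⟩
    have := hL t (y w)
    have := ha t
    have := abs_nonneg (L t (y w'))
    simp only; linarith
  have stepA : 𝔼 w, ⨆ t, (a t + |L t (y w)|) ≤ 𝔼 w, (b + 𝔼 w', h w w') := by
    refine Finset.expect_le_expect fun w _ => ciSup_le fun t => ?_
    have h1 : 𝔼 w', (a t + |L t (y w)| - |L t (y w')|) ≤ 𝔼 w', h w w' :=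
      Finset.expect_le_expect fun w' _ => hhle w w' t
    rw [Finset.expect_sub_distrib, Fintype.expect_const] at h1
    have := hb t
    linarith
  have stepB : ∀ w w', h w w' + h w' w ≤
      (g (y w) + g (- y w)) / 2 + (g (y w') + g (- y w')) / 2 := by
    intro w w'
    have : h w w' ≤ ((g (y w) + g (- y w)) / 2 + (g (y w') + g (- y w')) / 2) - h w' w := by
      refine ciSup_le fun t => ?_
      have : h w' w ≤ ((g (y w) + g (- y w)) / 2 + (g (y w') + g (- y w')) / 2)
          - (a t + |L t (y w)| - |L t (y w')|) := by
        refine ciSup_le fun t' => ?_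
        have key : ∀ z : F, (a t + a t') / 2 + |L t z - L t' z| ≤ (g z + g (-z)) / 2 := by
          intro z
          have h1 := hgle t z
          have h2 := hgle t' z
          have h3 := hgle t (-z)
          have h4 := hgle t' (-z)
          rw [map_neg] at h3 h4
          rcases abs_cases (L t z - L t' z) with ⟨h, _⟩ | ⟨h, _⟩ <;> rw [h] <;> linarith
        have k1 := key (y w)
        have k2 := key (y w')
        have k3 := abs_sub_abs_le_abs_sub (L t (y w)) (L t' (y w))
        have k4 := abs_sub_abs_le_abs_sub (L t' (y w')) (L t (y w'))
        rw [abs_sub_comm (L t' (y w'))] at k4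
        linarith
      linarith
    linarith
  have hneg : 𝔼 w, g (- y w) = 𝔼 w, g (y w) :=
    Fintype.expect_equiv nu _ _ (fun w => by rw [hnu])
  have hsum : 𝔼 w, 𝔼 w', h w w' ≤ 𝔼 w, g (y w) := by
    have h1 : 𝔼 w, 𝔼 w', (h w w' + h w' w) ≤ 𝔼 w, 𝔼 w',
      ((g (y w) + g (- y w)) / 2 + (g (y w') + g (- y w')) / 2) :=
      Finset.expect_le_expect fun w _ => Finset.expect_le_expect fun w' _ => stepB w w'
    simp only [Finset.expect_add_distrib, ← Finset.expect_div, Fintype.expect_const, hneg] at h1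
    rw [Finset.expect_comm (f := fun w w' => h w' w)] at h1
    linarith
  rw [Finset.expect_add_distrib, Fintype.expect_const] at stepA
  linarith

lemma decouple {T Ω : Type*} [Nonempty T] [Fintype Ω] [Nonempty Ω]
    (L : T → F →ₗ[ℝ] ℝ) (hL : ∀ t z, |L t z| ≤ ‖z‖) (y : Ω → F) (nu : Ω ≃ Ω)
    (hnu : ∀ w, y (nu w) = - y w) (b : ℝ) (hb : ∀ t, 𝔼 w, |L t (y w)| ≤ b) {m : ℕ} :
    ∀ (a : T → ℝ) (A : ℝ) (_ : ∀ t, a t ≤ A),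
    𝔼 w : Fin m → Ω, ⨆ t, (a t + ∑ s, |L t (y (w s))|) ≤
      m * b + 𝔼 w : Fin m → Ω, ⨆ t, (a t + 2 * ∑ s, L t (y (w s))) := by
  induction m with
  | zero => intro a A ha; simp
  | succ m ih =>
    intro a A ha
    rw [expect_cons, expect_cons]
    simp only [Fin.sum_univ_succ, Fin.cons_zero, Fin.cons_succ]
    rw [Finset.expect_comm]
    have h1 : ∀ w : Fin m → Ω, 𝔼 u, ⨆ t, (a t + (|L t (y u)| + ∑ s, |L t (y (w s))|)) ≤
        b + 𝔼 u, ⨆ t, ((a t + 2 * L t (y u)) + ∑ s, |L t (y (w s))|) := by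
      intro w
      have := decouple_one L hL y nu hnu b hb (fun t => a t + ∑ s, |L t (y (w s))|)
        (A + ∑ s, ‖y (w s)‖) (fun t => add_le_add (ha t) (Finset.sum_le_sum fun s _ => hL _ _))
      refine le_trans (le_of_eq ?_) (this.trans (le_of_eq ?_))
      · refine Finset.expect_congr rfl fun u _ => ?_
        congr 1; funext t; ring
      · congr 1
        refine Finset.expect_congr rfl fun u _ => ?_
        congr 1; funext t; ring
    refine (Finset.expect_le_expect fun w _ => h1 w).trans ?_
    rw [Finset.expect_add_distrib, Fintype.expect_const, Finset.expect_comm]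
    have h2 : ∀ u, 𝔼 w : Fin m → Ω, ⨆ t, ((a t + 2 * L t (y u)) + ∑ s, |L t (y (w s))|) ≤
        m * b + 𝔼 w : Fin m → Ω, ⨆ t, (a t + 2 * (L t (y u) + ∑ s, L t (y (w s)))) := by
      intro u
      have := ih (fun t => a t + 2 * L t (y u)) (A + 2 * ‖y u‖) (fun t => by
        have := le_of_abs_le (hL t (y u))
        have := ha t
        linarith)
      refine this.trans (le_of_eq ?_)
      congr 1
      refine Finset.expect_congr rfl fun w _ => ?_
      congr 1; funext t; ring
    have h3 := Finset.expect_le_expect (s := univ) fun u _ => h2 u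
    rw [Finset.expect_add_distrib, Fintype.expect_const] at h3
    push_cast
    linarith

/-- Application: expected weak-1 norm of a random sample. -/
lemma expect_weak_one {ι : Type*} [Fintype ι] [DecidableEq ι] (x : ι → F)
    (hx : ∀ φ : F →L[ℝ] ℝ, ‖φ‖ ≤ 1 → ∑ i, φ (x i) ^ 2 ≤ 1) (m : ℕ) :
    𝔼 w : Fin m → ι → ℤˣ, (⨆ φ : {φ : F →L[ℝ] ℝ // ‖φ‖ ≤ 1}, ∑ s, |φ.1 (ssum x (w s))|) ≤
      m + 2 * 𝔼 w : Fin m → ι → ℤˣ, ‖∑ s, ssum x (w s)‖ := by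
  have : Nonempty {φ : F →L[ℝ] ℝ // ‖φ‖ ≤ 1} := ⟨⟨0, by simp⟩⟩
  have hL : ∀ (t : {φ : F →L[ℝ] ℝ // ‖φ‖ ≤ 1}) (z : F), |t.1 z| ≤ ‖z‖ := fun t z =>
    (t.1.le_opNorm z).trans (by nlinarith [norm_nonneg z, t.2])
  have := decouple (m := m) (fun t : {φ : F →L[ℝ] ℝ // ‖φ‖ ≤ 1} => (t.1 : F →ₗ[ℝ] ℝ)) hL
    (fun e : ι → ℤˣ => ssum x e) (Equiv.neg _)
    (fun w => by simp [ssum, sg_neg]) 1 (fun t => by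
      have h1 : 𝔼 e : ι → ℤˣ, (t.1 (ssum x e)) ^ 2 ≤ 1 := by
        have := expect_sq (fun i => t.1 (x i))
        have h2 := hx t.1 t.2
        rw [← this] at h2
        simpa [ssum] using h2
      have h2 : 𝔼 e : ι → ℤˣ, |t.1 (ssum x e)| ≤ 𝔼 e : ι → ℤˣ, (1 + (t.1 (ssum x e)) ^ 2) / 2 :=
        Finset.expect_le_expect fun e _ => by
          nlinarith [sq_nonneg (|t.1 (ssum x e)| - 1), sq_abs (t.1 (ssum x e))]
      rw [← Finset.expect_div, Finset.expect_add_distrib, Fintype.expect_const] at h2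
      simp only [ContinuousLinearMap.coe_coe]
      linarith) (fun _ => 0) 0 (fun _ => le_rfl)
  simp only [zero_add, mul_one, ContinuousLinearMap.coe_coe] at this
  refine this.trans ?_
  rw [Finset.mul_expect]
  gcongr with w
  refine ciSup_le fun t => ?_
  rw [← map_sum]
  exact mul_le_mul_of_nonneg_left (le_of_abs_le (hL t _)) (by norm_num)

/-- translation invariance -/
lemma expect_translate {G : Type*} [Fintype G] [Group G] (f : G → ℝ) (g : G) :
    𝔼 w, f (g * w) = 𝔼 w, f w :=
  Fintype.expect_equiv (Equiv.mulLeft g) _ _ (fun _ => rfl)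

lemma expect_marginal {ι : Type*} [Fintype ι] [DecidableEq ι] {m : ℕ} (i : ι)
    (f : (Fin m → ℤˣ) → ℝ) :
    𝔼 w : Fin m → ι → ℤˣ, f (fun s => w s i) = 𝔼 h : Fin m → ℤˣ, f h := by
  have h1 : ∀ h : Fin m → ℤˣ, 𝔼 w : Fin m → ι → ℤˣ, f (h * fun s => w s i) =
      𝔼 w : Fin m → ι → ℤˣ, f (fun s => w s i) := fun h =>
    expect_translate (fun w : Fin m → ι → ℤˣ => f (fun s => w s i)) (fun s _ => h s)
  have h2 := Fintype.expect_const (ι := Fin m → ℤˣ) (𝔼 w : Fin m → ι → ℤˣ, f (fun s => w s i))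
  rw [← h2]
  rw [Finset.expect_congr rfl fun h _ => (h1 h).symm, Finset.expect_comm]
  have h3 : ∀ w : Fin m → ι → ℤˣ, 𝔼 h : Fin m → ℤˣ, f (h * fun s => w s i) = 𝔼 h, f h := by
    intro w
    have := expect_translate f (fun s => w s i)
    rw [← this]
    simp only [mul_comm]
  rw [Finset.expect_congr rfl fun w _ => h3 w, Fintype.expect_const]

lemma norm_expect_le {Ω ι : Type*} [Fintype Ω] [Fintype ι] (c : Ω → ι → ℝ) (x : ι → F) :
    ‖∑ i, (𝔼 w, c w i) • x i‖ ≤ 𝔼 w, ‖∑ i, c w i • x i‖ := by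
  obtain ⟨φ, hφ, h⟩ := exists_dual_vector'' ℝ (∑ i, (𝔼 w, c w i) • x i)
  have h' : ‖∑ i, (𝔼 w, c w i) • x i‖ = φ (∑ i, (𝔼 w, c w i) • x i) := by simpa using h.symm
  rw [h']
  have : φ (∑ i, (𝔼 w, c w i) • x i) = 𝔼 w, φ (∑ i, c w i • x i) := by
    simp only [map_sum, map_smul, smul_eq_mul]
    rw [Finset.expect_sum_comm]
    refine Finset.sum_congr rfl fun i _ => ?_
    rw [Finset.expect_mul]
  rw [this]
  refine Finset.expect_le_expect fun w _ => ?_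
  have := φ.le_opNorm (∑ i, c w i • x i)
  have h2 := le_of_abs_le (a := φ (∑ i, c w i • x i)) this
  nlinarith [norm_nonneg (∑ i, c w i • x i)]

lemma lower_bound {ι : Type*} [Fintype ι] [DecidableEq ι] (x : ι → F) (m : ℕ) :
    Real.sqrt m / 8 * 𝔼 e : ι → ℤˣ, ‖ssum x e‖ ≤ 𝔼 w : Fin m → ι → ℤˣ, ‖∑ s, ssum x (w s)‖ := by
  set S : (Fin m → ι → ℤˣ) → ι → ℝ := fun w i => ∑ s, sg (w s i) with hS
  have e1 : ∀ w : Fin m → ι → ℤˣ, ∑ s, ssum x (w s) = ∑ i, S w i • x i := by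
    intro w
    simp only [ssum, hS, Finset.sum_smul]
    rw [Finset.sum_comm]
  set c : ℝ := 𝔼 h : Fin m → ℤˣ, |∑ s, sg (h s)| with hc
  have hc1 : Real.sqrt m / 8 ≤ c := by
    have h2 := expect_sq (fun _ : Fin m => (1:ℝ))
    have h4 := hyper (fun _ : Fin m => (1:ℝ))
    simp only [Real.norm_eq_abs, sq_abs, h2] at h4
    have hm : ∑ i : Fin m, (1:ℝ) ^ 2 = Real.sqrt m ^ 2 := by simp
    rw [hm] at h4 h2
    have := l1_l2 (fun e => |ssum (fun _ : Fin m => (1:ℝ)) e|) (fun _ => abs_nonneg _)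
      (Real.sqrt m) (Real.sqrt_nonneg _) (by simpa only [sq_abs] using h2) h4
    simpa [ssum, hc] using this
  have hc2 : ∀ i, 𝔼 w : Fin m → ι → ℤˣ, |S w i| = c := fun i =>
    expect_marginal i (fun h => |∑ s, sg (h s)|)
  have hρ : 0 ≤ 𝔼 e : ι → ℤˣ, ‖ssum x e‖ := Finset.expect_nonneg fun _ _ => norm_nonneg _
  have step : ∀ e : ι → ℤˣ, c * ‖ssum x e‖ ≤
      𝔼 w : Fin m → ι → ℤˣ, ‖∑ i, (sg (e i) * |S w i|) • x i‖ := by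
    intro e
    refine le_trans (le_of_eq ?_) (norm_expect_le (fun w i => sg (e i) * |S w i|) x)
    simp only [← Finset.mul_expect, hc2]
    have hc0 : 0 ≤ c := Finset.expect_nonneg fun _ _ => abs_nonneg _
    rw [← Real.norm_of_nonneg hc0, ← norm_smul, ssum, Finset.smul_sum]
    congr 1
    refine Finset.sum_congr rfl fun i _ => ?_
    rw [smul_smul, mul_comm, Real.norm_of_nonneg hc0]
  have step2 : 𝔼 e : ι → ℤˣ, 𝔼 w : Fin m → ι → ℤˣ, ‖∑ i, (sg (e i) * |S w i|) • x i‖ =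
      𝔼 w : Fin m → ι → ℤˣ, ‖∑ i, S w i • x i‖ := by
    have a1 : ∀ e : ι → ℤˣ, 𝔼 w : Fin m → ι → ℤˣ, ‖∑ i, (sg (e i) * S w i) • x i‖ =
        𝔼 w : Fin m → ι → ℤˣ, ‖∑ i, S w i • x i‖ := by
      intro e
      rw [← expect_translate (fun w : Fin m → ι → ℤˣ => ‖∑ i, S w i • x i‖) (fun _ => e)]
      refine Finset.expect_congr rfl fun w _ => ?_
      congr 1
      refine Finset.sum_congr rfl fun i _ => ?_
      simp only [hS, Pi.mul_apply, sg_mul, Finset.mul_sum]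
    rw [← Fintype.expect_const (ι := ι → ℤˣ) (𝔼 w : Fin m → ι → ℤˣ, ‖∑ i, S w i • x i‖)]
    rw [← Finset.expect_congr rfl fun e _ => a1 e]
    rw [Finset.expect_comm, Finset.expect_comm (s := univ) (t := univ)
      (f := fun (e : ι → ℤˣ) (w : Fin m → ι → ℤˣ) => ‖∑ i, (sg (e i) * S w i) • x i‖)]
    refine Finset.expect_congr rfl fun w _ => ?_
    rw [← expect_translate _ (fun i => if 0 ≤ S w i then (1 : ℤˣ) else -1)]
    refine Finset.expect_congr rfl fun e _ => ?_
    congr 1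
    refine Finset.sum_congr rfl fun i _ => ?_
    congr 1
    simp only [Pi.mul_apply, sg_mul]
    split_ifs with h
    · rw [abs_of_nonneg h, sg_one, one_mul]
    · rw [abs_of_neg (not_le.mp h), sg_neg_one]; ring
  simp only [e1]
  rw [← step2]
  refine le_trans (mul_le_mul_of_nonneg_right hc1 hρ) ?_
  rw [Finset.mul_expect]
  exact Finset.expect_le_expect fun e _ => step e

/-- Core contradiction: an upper estimate forces Rademacher averages (with weak 2-norm at most 1) to be
bounded. -/
lemma core (A : ℝ) (hA0 : 0 < A)
    (hA : ∀ (k : ℕ) (y : Fin k → F) (M W : ℝ), 0 < M → (∀ s, ‖y s‖ ≤ M) →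
      (∀ φ : F →L[ℝ] ℝ, ‖φ‖ ≤ 1 → ∑ s, |φ (y s)| ≤ W) →
      𝔼 e : Fin k → ℤˣ, ‖ssum y e‖ ≤ A * M + W / 10)
    {ι : Type*} [Fintype ι] [DecidableEq ι] (x : ι → F)
    (hx : ∀ φ : F →L[ℝ] ℝ, ‖φ‖ ≤ 1 → ∑ i, φ (x i) ^ 2 ≤ 1) (μ : ℕ) (hμ : 1 ≤ μ)
    (hρ : 8 * (μ:ℝ) ^ 2 ≤ 𝔼 e : ι → ℤˣ, ‖ssum x e‖) :
    (μ:ℝ) ≤ 16 * 65537 * A := by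
  set ρ := 𝔼 e : ι → ℤˣ, ‖ssum x e‖ with hρd
  have hμ' : (1:ℝ) ≤ μ := by exact_mod_cast hμ
  have hρ0 : 0 < ρ := lt_of_lt_of_le (by positivity) hρ
  set m := μ ^ 4 with hm
  set Λ := 𝔼 w : Fin m → ι → ℤˣ, ‖∑ s, ssum x (w s)‖ with hΛ
  have hlow : (μ:ℝ) ^ 2 / 8 * ρ ≤ Λ := by
    have := lower_bound x m
    have e : Real.sqrt (m:ℝ) = (μ:ℝ) ^ 2 := by
      rw [hm]; push_cast
      rw [show (μ:ℝ) ^ 4 = ((μ:ℝ) ^ 2) ^ 2 by ring]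
      exact Real.sqrt_sq (by positivity)
    rwa [e] at this
  have hW := expect_weak_one x hx m
  rw [← hΛ] at hW
  set W : (Fin m → ι → ℤˣ) → ℝ := fun w =>
    (⨆ φ : {φ : F →L[ℝ] ℝ // ‖φ‖ ≤ 1}, ∑ s, |φ.1 (ssum x (w s))|) with hWd
  set β : ℝ := μ * ρ with hβ
  have hβ0 : 0 < β := by positivity
  set M : (Fin m → ι → ℤˣ) → ℝ := fun w => β + (∑ s, ‖ssum x (w s)‖ ^ 4) / β ^ 3 with hM
  have hpt : ∀ w : Fin m → ι → ℤˣ,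
      𝔼 e : Fin m → ℤˣ, ‖ssum (fun s => ssum x (w s)) e‖ ≤ A * M w + W w / 10 := by
    intro w
    refine hA m _ _ _ ?_ ?_ ?_
    · have : 0 ≤ (∑ s, ‖ssum x (w s)‖ ^ 4) / β ^ 3 := by positivity
      simp only [hM]; linarith
    · intro s
      have h1 : ‖ssum x (w s)‖ ^ 4 ≤ ∑ s, ‖ssum x (w s)‖ ^ 4 :=
        Finset.single_le_sum (f := fun s => ‖ssum x (w s)‖ ^ 4) (fun _ _ => by positivity)
          (Finset.mem_univ s)
      have h2 : ‖ssum x (w s)‖ ^ 4 / β ^ 3 ≤ (∑ s, ‖ssum x (w s)‖ ^ 4) / β ^ 3 := by gcongr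
      have h3 : ‖ssum x (w s)‖ ≤ β + ‖ssum x (w s)‖ ^ 4 / β ^ 3 := by
        set t := ‖ssum x (w s)‖
        have ht : 0 ≤ t := norm_nonneg _
        rcases le_total t β with h | h
        · have : 0 ≤ t ^ 4 / β ^ 3 := by positivity
          linarith
        · have : t ≤ t ^ 4 / β ^ 3 := by
            rw [le_div_iff₀ (by positivity)]
            have := pow_le_pow_left₀ hβ0.le h 3
            nlinarith
          linarith
      simp only [hM]; linarith
    · intro φ hφ
      refine le_ciSup (f := fun φ : {φ : F →L[ℝ] ℝ // ‖φ‖ ≤ 1} => ∑ s, |φ.1 (ssum x (w s))|)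
        ⟨∑ s, ‖ssum x (w s)‖, ?_⟩ ⟨φ, hφ⟩
      rintro _ ⟨t, rfl⟩
      refine Finset.sum_le_sum fun s _ => ?_
      exact (t.1.le_opNorm _).trans (by nlinarith [norm_nonneg (ssum x (w s)), t.2])
  have hav := Finset.expect_le_expect (s := univ) fun w _ => hpt w
  have hleft : 𝔼 w : Fin m → ι → ℤˣ, 𝔼 e : Fin m → ℤˣ, ‖ssum (fun s => ssum x (w s)) e‖ = Λ := by
    rw [Finset.expect_comm]
    have : ∀ e : Fin m → ℤˣ, 𝔼 w : Fin m → ι → ℤˣ, ‖ssum (fun s => ssum x (w s)) e‖ = Λ := by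
      intro e
      rw [hΛ, ← expect_translate (fun w : Fin m → ι → ℤˣ => ‖∑ s, ssum x (w s)‖) (fun s _ => e s)]
      refine Finset.expect_congr rfl fun w _ => ?_
      congr 1
      simp [ssum, sg_mul, Finset.smul_sum, smul_smul]
    rw [Finset.expect_congr rfl fun e _ => this e, Fintype.expect_const]
  rw [hleft, Finset.expect_add_distrib, ← Finset.mul_expect, ← Finset.expect_div] at hav
  have hEM : 𝔼 w, M w ≤ 65537 * μ * ρ := by
    simp only [hM]
    rw [Finset.expect_add_distrib, Fintype.expect_const, ← Finset.expect_div,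
      Finset.expect_sum_comm]
    have h4 : ∀ s : Fin m, 𝔼 w : Fin m → ι → ℤˣ, ‖ssum x (w s)‖ ^ 4 ≤ 65536 * ρ ^ 4 := by
      intro s
      have : 𝔼 w : Fin m → ι → ℤˣ, ‖ssum x (w s)‖ ^ 4 = 𝔼 e : ι → ℤˣ, ‖ssum x e‖ ^ 4 := by
        have h1 : ∀ h : ι → ℤˣ, 𝔼 w : Fin m → ι → ℤˣ, ‖ssum x (h * w s)‖ ^ 4 =
            𝔼 w : Fin m → ι → ℤˣ, ‖ssum x (w s)‖ ^ 4 := fun h =>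
          expect_translate (fun w : Fin m → ι → ℤˣ => ‖ssum x (w s)‖ ^ 4) (fun _ => h)
        rw [← Fintype.expect_const (ι := ι → ℤˣ) (𝔼 w : Fin m → ι → ℤˣ, ‖ssum x (w s)‖ ^ 4)]
        rw [Finset.expect_congr rfl fun h _ => (h1 h).symm, Finset.expect_comm]
        have h3 : ∀ w : Fin m → ι → ℤˣ, 𝔼 h : ι → ℤˣ, ‖ssum x (h * w s)‖ ^ 4 =
            𝔼 e : ι → ℤˣ, ‖ssum x e‖ ^ 4 := by
          intro w
          rw [← expect_translate (fun e : ι → ℤˣ => ‖ssum x e‖ ^ 4) (w s)]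
          simp only [mul_comm]
        rw [Finset.expect_congr rfl fun w _ => h3 w, Fintype.expect_const]
      rw [this]
      exact fourth_le x
    have h5 : ∑ s : Fin m, 𝔼 w : Fin m → ι → ℤˣ, ‖ssum x (w s)‖ ^ 4 ≤
        (μ:ℝ) ^ 4 * (65536 * ρ ^ 4) := by
      refine (Finset.sum_le_sum fun s _ => h4 s).trans (le_of_eq ?_)
      simp [hm]
    have h6 : (∑ s : Fin m, 𝔼 w : Fin m → ι → ℤˣ, ‖ssum x (w s)‖ ^ 4) / β ^ 3 ≤
        65536 * μ * ρ := by
      rw [div_le_iff₀ (by positivity)]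
      refine h5.trans (le_of_eq ?_)
      rw [hβ]; ring
    rw [hβ] at h6 ⊢
    linarith
  have hmΛ : (m:ℝ) ≤ Λ := by
    refine le_trans ?_ hlow
    rw [hm]; push_cast
    nlinarith [sq_nonneg (μ:ℝ)]
  have hfin : Λ ≤ 2 * A * (65537 * μ * ρ) := by
    have := mul_le_mul_of_nonneg_left hEM hA0.le
    have hΛ0 : 0 ≤ Λ := le_trans (by positivity) hmΛ
    nlinarith
  have := hlow.trans hfin
  have h7 : (μ * ρ) * (μ:ℝ) ≤ (μ * ρ) * (16 * 65537 * A) := by nlinarith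
  exact le_of_mul_le_mul_left h7 (by positivity)

end Decouple

/-! ### Dvoretzky-Rogers lemma via maximal determinant -/

section John

open Module

lemma det_one_add_proj {G : Type*} [NormedAddCommGroup G] [InnerProductSpace ℝ G]
    [FiniteDimensional ℝ G] (H : Submodule ℝ G) :
    LinearMap.det (LinearMap.id + (H.starProjection : G →ₗ[ℝ] G)) = 2 ^ (finrank ℝ H) := by
  have hc : IsCompl H Hᗮ := Submodule.isCompl_orthogonal H
  set e := Submodule.prodEquivOfIsCompl H Hᗮ hc
  have : (LinearMap.id + (H.starProjection : G →ₗ[ℝ] G)) =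
      (e : (H × Hᗮ) →ₗ[ℝ] G) ∘ₗ (LinearMap.prodMap ((2:ℝ) • LinearMap.id) LinearMap.id) ∘ₗ
        (e.symm : G →ₗ[ℝ] (H × Hᗮ)) := by
    ext z
    obtain ⟨⟨h, h'⟩, rfl⟩ := e.surjective z
    have h1 : H.starProjection (h : G) = h := Submodule.starProjection_eq_self_iff.mpr h.2
    have h2 : H.starProjection (h' : G) = 0 :=
      (Submodule.starProjection_apply_eq_zero_iff H).mpr h'.2
    simp [e, h1, h2, two_smul]
    abel
  rw [this, LinearMap.det_conj, LinearMap.det_prodMap, LinearMap.det_smul]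
  simp

lemma john {F : Type*} [NormedAddCommGroup F] [NormedSpace ℝ F] (hF : ¬ FiniteDimensional ℝ F)
    (N : ℕ) : ∃ u : EuclideanSpace ℝ (Fin N) →L[ℝ] F, ‖u‖ ≤ 1 ∧
      ∀ H : Submodule ℝ (EuclideanSpace ℝ (Fin N)), ∀ τ : ℝ, 0 ≤ τ →
        (∀ z ∈ H, ‖u z‖ ≤ τ * ‖z‖) → (2:ℝ) ^ (finrank ℝ H) ≤ (1 + τ) ^ N := by
  set G := EuclideanSpace ℝ (Fin N) with hG
  obtain ⟨v, hv⟩ : ∃ v : Fin N → F, LinearIndependent ℝ v := by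
    have hr : (N : Cardinal) ≤ Module.rank ℝ F := by
      have : Cardinal.aleph0 ≤ Module.rank ℝ F := by
        by_contra h
        exact hF (Module.rank_lt_aleph0_iff.mp (not_le.mp h))
      exact (Cardinal.natCast_le_aleph0).trans this
    obtain ⟨s, hs, hli⟩ := le_rank_iff_exists_linearIndependent_finset.mp hr
    refine ⟨fun i => ((s.equivFinOfCardEq hs).symm i : F), ?_⟩
    exact hli.comp _ (s.equivFinOfCardEq hs).symm.injective
  set L0 : G →ₗ[ℝ] F := (Fintype.linearCombination ℝ v) ∘ₗ
    (WithLp.linearEquiv 2 ℝ (Fin N → ℝ)).toLinearMap with hL0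
  have hinj : LinearMap.ker L0 = ⊥ := by
    rw [hL0, LinearMap.ker_eq_bot]
    simp only [LinearMap.coe_comp]
    refine Function.Injective.comp ?_ (LinearEquiv.injective _)
    exact linearIndependent_iff_injective_fintypeLinearCombination.mp hv
  set L : G →L[ℝ] F := LinearMap.toContinuousLinearMap L0 with hL
  obtain ⟨K, hK, hanti⟩ := (L0).exists_antilipschitzWith hinj
  set S : Set (G →L[ℝ] G) := {A | ‖L.comp A‖ ≤ 1} with hS
  have hScl : IsClosed S := by
    refine isClosed_le ?_ continuous_const
    exact continuous_norm.comp ((ContinuousLinearMap.compL ℝ G G F L).continuous)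
  have hSb : S ⊆ Metric.closedBall 0 (K:ℝ) := by
    intro A hA
    rw [mem_closedBall_zero_iff]
    refine ContinuousLinearMap.opNorm_le_bound _ K.2 fun z => ?_
    have h1 := hanti.le_mul_dist (A z) 0
    simp only [map_zero, dist_zero_right] at h1
    refine h1.trans ?_
    have h2 : ‖L0 (A z)‖ ≤ 1 * ‖z‖ := (L.comp A).le_of_opNorm_le hA z
    rw [one_mul] at h2
    exact mul_le_mul_of_nonneg_left h2 K.2
  have : ProperSpace (G →L[ℝ] G) := FiniteDimensional.proper ℝ _
  have hScomp : IsCompact S := (isCompact_closedBall (0 : G →L[ℝ] G) (K:ℝ)).of_isClosed_subset hScl hSb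
  have hcont : Continuous fun A : G →L[ℝ] G => |A.det| :=
    continuous_abs.comp ContinuousLinearMap.continuous_det
  obtain ⟨A, hAS, hAmax⟩ := hScomp.exists_isMaxOn ⟨0, by simp [hS]⟩ hcont.continuousOn
  have hpos : 0 < |A.det| := by
    have hmem : (1 / (1 + ‖L‖)) • ContinuousLinearMap.id ℝ G ∈ S := by
      simp only [hS, Set.mem_ofPred_eq, ContinuousLinearMap.comp_smul, ContinuousLinearMap.comp_id]
      rw [norm_smul, Real.norm_of_nonneg (by positivity), one_div, inv_mul_le_iff₀ (by positivity)]
      linarith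
    refine lt_of_lt_of_le ?_ (hAmax hmem)
    simp only [ContinuousLinearMap.det, ContinuousLinearMap.toLinearMap_smul, ContinuousLinearMap.coe_id,
      LinearMap.det_smul, LinearMap.det_id]
    positivity
  refine ⟨L.comp A, hAS, fun H τ hτ hH => ?_⟩
  set B : G →L[ℝ] G := (1 / (1 + τ)) • A.comp (ContinuousLinearMap.id ℝ G + H.starProjection) with hB
  have hBS : B ∈ S := by
    simp only [hS, Set.mem_ofPred_eq]
    refine ContinuousLinearMap.opNorm_le_bound _ zero_le_one fun z => ?_
    have e : (L.comp B) z = (1 / (1 + τ)) • (L.comp A z + L.comp A (H.starProjection z)) := by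
      simp [hB]
    rw [e, norm_smul, Real.norm_of_nonneg (by positivity), one_div,
      inv_mul_le_iff₀ (by positivity), one_mul]
    refine (norm_add_le _ _).trans ?_
    have h1 : ‖L.comp A z‖ ≤ 1 * ‖z‖ := (L.comp A).le_of_opNorm_le hAS z
    have h2 := hH (H.starProjection z) (Submodule.starProjection_apply_mem _ _)
    have h3 : ‖H.starProjection z‖ ≤ ‖z‖ := Submodule.norm_starProjection_apply_le _ _
    have h4 := mul_le_mul_of_nonneg_left h3 hτ
    linarith
  have hle : |B.det| ≤ |A.det| := hAmax hBS
  have hBdet : B.det = (1 / (1 + τ)) ^ N * (A.det * 2 ^ finrank ℝ H) := by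
    have := det_one_add_proj H
    simp only [ContinuousLinearMap.det, hB]
    rw [ContinuousLinearMap.toLinearMap_smul, LinearMap.det_smul, ContinuousLinearMap.toLinearMap_comp,
      LinearMap.det_comp, ContinuousLinearMap.toLinearMap_add, ContinuousLinearMap.coe_id, this]
    have hfr : finrank ℝ G = N := finrank_euclideanSpace_fin
    rw [hfr]
  rw [hBdet, abs_mul, abs_mul, abs_of_nonneg (by positivity : (0:ℝ) ≤ (1 / (1 + τ)) ^ N),
    abs_of_nonneg (by positivity : (0:ℝ) ≤ 2 ^ finrank ℝ H), one_div, inv_pow,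
    inv_mul_le_iff₀ (by positivity), mul_comm] at hle
  exact le_of_mul_le_mul_right hle hpos

lemma dvoretzky_rogers {F : Type*} [NormedAddCommGroup F] [NormedSpace ℝ F]
    (hF : ¬ FiniteDimensional ℝ F) (k : ℕ) (hk : 1 ≤ k) :
    ∃ v : Fin k → F, (∀ j, 2 / 5 ≤ ‖v j‖) ∧
      ∀ φ : F →L[ℝ] ℝ, ‖φ‖ ≤ 1 → ∑ j, φ (v j) ^ 2 ≤ 1 := by
  obtain ⟨u, hu, hH⟩ := john hF (2 * k)
  have hpick : ∀ H : Submodule ℝ (EuclideanSpace ℝ (Fin (2 * k))), k ≤ finrank ℝ H →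
      ∃ f ∈ H, ‖f‖ = 1 ∧ 2 / 5 ≤ ‖u f‖ := by
    intro H hHk
    by_contra! hcon
    have h1 := hH H (2/5) (by norm_num) (fun z hz => by
      by_cases hz0 : z = 0
      · simp [hz0]
      have hzn : 0 < ‖z‖ := norm_pos_iff.mpr hz0
      have := hcon (‖z‖⁻¹ • z) (H.smul_mem _ hz) (by rw [norm_smul, norm_inv, norm_norm]; field_simp)
      rw [map_smul, norm_smul, norm_inv, norm_norm, inv_mul_lt_iff₀ hzn] at this
      linarith)
    have h2 : (2:ℝ) ^ k ≤ 2 ^ finrank ℝ H := pow_le_pow_right₀ (by norm_num) hHk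
    have h3 := h2.trans h1
    rw [pow_mul] at h3
    have h4 := le_of_pow_le_pow_left₀ (by omega) (by norm_num) h3
    norm_num at h4
  have hsel : ∀ j : ℕ, j ≤ k → ∃ f : Fin j → EuclideanSpace ℝ (Fin (2 * k)),
      Orthonormal ℝ f ∧ ∀ i, 2 / 5 ≤ ‖u (f i)‖ := by
    intro j
    induction j with
    | zero => exact fun _ => ⟨Fin.elim0, ⟨fun i => i.elim0, fun i => i.elim0⟩, fun i => i.elim0⟩
    | succ j ih =>
      intro hj
      obtain ⟨f, hf, hfu⟩ := ih (by omega)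
      set V := Submodule.span ℝ (Set.range f)
      have hV : finrank ℝ V ≤ j := by
        have := finrank_range_le_card (R := ℝ) f
        rw [Set.finrank] at this
        simpa using this
      have hsum := Submodule.finrank_add_finrank_orthogonal V
      simp only [finrank_euclideanSpace, Fintype.card_fin] at hsum
      obtain ⟨g, hgV, hg1, hgu⟩ := hpick Vᗮ (by omega)
      have hgf : ∀ i, inner ℝ (f i) g = 0 := fun i =>
        (Submodule.mem_orthogonal _ _).mp hgV _ (Submodule.subset_span ⟨i, rfl⟩)
      refine ⟨Fin.cons g f, ⟨?_, ?_⟩, ?_⟩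
      · intro i
        refine Fin.cases ?_ (fun i => ?_) i
        · simpa using hg1
        · simpa using hf.1 i
      · intro i i' hii
        induction i using Fin.cases with
        | zero =>
          induction i' using Fin.cases with
          | zero => exact absurd rfl hii
          | succ i' => simpa [real_inner_comm] using hgf i'
        | succ i =>
          induction i' using Fin.cases with
          | zero => simpa using hgf i
          | succ i' => simpa using hf.2 (fun h => hii (by rw [h]))
      · intro i
        refine Fin.cases ?_ (fun i => ?_) i
        · simpa using hgu
        · simpa using hfu i
  obtain ⟨f, hf, hfu⟩ := hsel k le_rfl
  refine ⟨fun j => u (f j), hfu, fun φ hφ => ?_⟩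
  set s := ∑ j, φ (u (f j)) ^ 2 with hs
  have hs0 : 0 ≤ s := Finset.sum_nonneg fun _ _ => sq_nonneg _
  set z := ∑ j, φ (u (f j)) • f j
  have hz : ‖z‖ ^ 2 = s := by
    rw [← real_inner_self_eq_norm_sq, hf.inner_sum]
    simp [hs, sq]
  have h1 : φ (u z) = s := by simp [z, hs, sq]
  have h2 : s ≤ ‖z‖ := by
    rw [← h1]
    refine (le_abs_self _).trans ((φ.le_opNorm _).trans ?_)
    have := u.le_opNorm z
    have h3 : ‖u z‖ ≤ ‖z‖ := this.trans (by nlinarith [norm_nonneg z])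
    nlinarith [norm_nonneg (u z)]
  nlinarith [norm_nonneg z]

end John

/-! ### Large Rademacher averages with weak 2-norm at most one -/

section Large

open scoped BigOperators

variable {F : Type*} [NormedAddCommGroup F] [NormedSpace ℝ F]

lemma single_le_expect {ι : Type*} [Fintype ι] [DecidableEq ι] (z : ι → F) (j : ι) :
    ‖z j‖ ≤ 𝔼 e : ι → ℤˣ, ‖∑ i, sg (e i) • z i‖ := by
  have h1 := expect_translate (fun e : ι → ℤˣ => ‖∑ i, sg (e i) • z i‖)
    (fun i => if i = j then 1 else -1)
  have h2 : 𝔼 _e : ι → ℤˣ, ‖z j‖ ≤ 𝔼 e : ι → ℤˣ, ((‖∑ i, sg (e i) • z i‖ +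
      ‖∑ i, sg (((fun i => if i = j then (1:ℤˣ) else -1) * e) i) • z i‖) / 2) := by
    refine Finset.expect_le_expect fun e _ => ?_
    have h3 : ∑ i, sg (e i) • z i + ∑ i, sg (((fun i => if i = j then (1:ℤˣ) else -1) * e) i) • z i
        = (2 * sg (e j)) • z j := by
      rw [← Finset.sum_add_distrib, Finset.sum_eq_single j]
      · simp [two_mul, add_smul]
      · intro i _ hij
        simp [hij, sg_neg]
      · simp
    have h4 := norm_add_le (∑ i, sg (e i) • z i)
      (∑ i, sg (((fun i => if i = j then (1:ℤˣ) else -1) * e) i) • z i)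
    rw [h3, norm_smul, norm_mul, Real.norm_eq_abs, Real.norm_eq_abs, sg_abs] at h4
    norm_num at h4 ⊢
    linarith
  rw [Fintype.expect_const, ← Finset.expect_div, Finset.expect_add_distrib, h1] at h2
  linarith

lemma none_le (Q : Type*) [Fintype Q] [DecidableEq Q] [Nonempty Q] (q : Q) :
    𝔼 w : Fin (Fintype.card Q) → Q, (if ∃ j, w j = q then (1:ℝ) else 0) ≥ 1 / 2 := by
  set k := Fintype.card Q with hk
  have hk0 : 0 < k := Fintype.card_pos
  have hk1 : (0:ℝ) < k := by exact_mod_cast hk0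
  have h1 : ∀ w : Fin k → Q, (if ∃ j, w j = q then (1:ℝ) else 0) =
      1 - ∏ j, (if w j = q then (0:ℝ) else 1) := by
    intro w
    split_ifs with h
    · obtain ⟨j, hj⟩ := h
      rw [Finset.prod_eq_zero (Finset.mem_univ j) (by simp [hj])]; simp
    · push Not at h
      simp [h]
  simp only [h1]
  rw [Finset.expect_sub_distrib, Fintype.expect_const]
  have h2 : 𝔼 w : Fin k → Q, ∏ j, (if w j = q then (0:ℝ) else 1) = (1 - 1 / k) ^ k := by
    rw [Fintype.expect_eq_sum_div_card]
    have := Finset.prod_univ_sum (fun _ : Fin k => (univ : Finset Q))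
      (fun _ x => if x = q then (0:ℝ) else 1)
    rw [Fintype.piFinset_univ] at this
    rw [← this]
    have h3 : ∑ x : Q, (if x = q then (0:ℝ) else 1) = k - 1 := by
      have : ∀ x : Q, (if x = q then (0:ℝ) else 1) = 1 - (if x = q then 1 else 0) := by
        intro x; split_ifs <;> simp
      simp [this, hk]
    rw [h3]
    simp only [Finset.prod_const, Finset.card_univ, Fintype.card_fin, Fintype.card_fun, ← hk]
    push_cast
    rw [← div_pow]
    congr 1
    field_simp
  rw [h2]
  have h4 : (1 - 1 / (k:ℝ)) ^ k ≤ Real.exp (-1) := by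
    have h5 : 1 - 1 / (k:ℝ) ≤ Real.exp (-(1 / k)) := Real.one_sub_le_exp_neg _
    have h6 : 0 ≤ 1 - 1 / (k:ℝ) := by
      rw [sub_nonneg, div_le_one hk1]; exact_mod_cast hk0
    refine (pow_le_pow_left₀ h6 h5 k).trans (le_of_eq ?_)
    rw [← Real.exp_nat_mul]
    congr 1; field_simp
  have h7 : Real.exp (-1) ≤ 1 / 2 := by
    rw [Real.exp_neg, one_div]
    exact inv_anti₀ (by norm_num) (by have := Real.add_one_le_exp (1:ℝ); linarith)
  linarith

lemma large (hF : ¬ FiniteDimensional ℝ F) (M : ℕ) (hM : 1 ≤ M) :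
    ∃ (k : ℕ) (x : Fin k × Fin M → F),
      (∀ φ : F →L[ℝ] ℝ, ‖φ‖ ≤ 1 → ∑ i, φ (x i) ^ 2 ≤ 1) ∧
      Real.sqrt M / 5 ≤ 𝔼 e : Fin k × Fin M → ℤˣ, ‖ssum x e‖ := by
  set k := Fintype.card (Fin M → ℤˣ) with hk
  have hk0 : 0 < k := Fintype.card_pos
  have hM0 : (0:ℝ) < M := by exact_mod_cast hM
  have hsM : 0 < Real.sqrt M := Real.sqrt_pos.mpr hM0
  obtain ⟨v, hv, hw⟩ := dvoretzky_rogers hF k hk0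
  refine ⟨k, fun i => (1 / Real.sqrt M) • v i.1, ?_, ?_⟩
  · intro φ hφ
    rw [Fintype.sum_prod_type]
    simp only [map_smul, smul_eq_mul, mul_pow, Finset.sum_const, Finset.card_univ, Fintype.card_fin,
      div_pow, Real.sq_sqrt hM0.le, nsmul_eq_mul]
    refine le_trans (le_of_eq ?_) (hw φ hφ)
    refine Finset.sum_congr rfl fun j _ => ?_
    field_simp
  · set a : (Fin k → Fin M → ℤˣ) → Fin k → ℝ := fun w j => (∑ l, sg (w j l)) / Real.sqrt M with ha
    have e1 : 𝔼 e : Fin k × Fin M → ℤˣ, ‖ssum (fun i : Fin k × Fin M => (1 / Real.sqrt M) • v i.1) e‖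
        = 𝔼 w : Fin k → Fin M → ℤˣ, ‖∑ j, a w j • v j‖ := by
      refine Fintype.expect_equiv (Equiv.curry _ _ _) _ _ fun e => ?_
      congr 1
      rw [ssum, Fintype.sum_prod_type]
      refine Finset.sum_congr rfl fun j _ => ?_
      simp only [ha, smul_smul, Finset.sum_div, Finset.sum_smul]
      refine Finset.sum_congr rfl fun l _ => ?_
      congr 1
      simp [Function.curry, div_eq_mul_inv]
    rw [e1]
    have a1 : ∀ e : Fin k → ℤˣ, 𝔼 w : Fin k → Fin M → ℤˣ, ‖∑ j, (sg (e j)) • a w j • v j‖ =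
        𝔼 w : Fin k → Fin M → ℤˣ, ‖∑ j, a w j • v j‖ := by
      intro e
      rw [← expect_translate (fun w : Fin k → Fin M → ℤˣ => ‖∑ j, a w j • v j‖) (fun j _ => e j)]
      refine Finset.expect_congr rfl fun w _ => ?_
      congr 1
      refine Finset.sum_congr rfl fun i _ => ?_
      simp only [ha, Pi.mul_apply, sg_mul, ← Finset.mul_sum, smul_smul, mul_div_assoc]
    rw [← Fintype.expect_const (ι := Fin k → ℤˣ) (𝔼 w : Fin k → Fin M → ℤˣ, ‖∑ j, a w j • v j‖)]
    rw [← Finset.expect_congr rfl fun e _ => a1 e, Finset.expect_comm]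
    have h1 : ∀ w : Fin k → Fin M → ℤˣ, (2 / 5 * Real.sqrt M) * (if ∃ j, w j = 1 then (1:ℝ) else 0) ≤
        𝔼 e : Fin k → ℤˣ, ‖∑ j, (sg (e j)) • a w j • v j‖ := by
      intro w
      split_ifs with h
      · obtain ⟨j, hj⟩ := h
        refine le_trans ?_ (single_le_expect (fun j => a w j • v j) j)
        have : a w j = Real.sqrt M := by
          simp [ha, hj, sg_one]
        rw [this, norm_smul, Real.norm_of_nonneg hsM.le]
        have := hv j
        nlinarith
      · rw [mul_zero]
        exact Finset.expect_nonneg fun _ _ => norm_nonneg _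
    refine le_trans ?_ (Finset.expect_le_expect fun w _ => h1 w)
    rw [← Finset.mul_expect]
    have := none_le (Fin M → ℤˣ) 1
    have h8 := mul_le_mul_of_nonneg_left this (by positivity : 0 ≤ 2 / 5 * Real.sqrt M)
    refine le_trans (le_of_eq ?_) h8
    ring

end Large

/-! ### The Rademacher norm as a finite average -/

section Rad

open scoped BigOperators

/-- unit-valued Rademacher functions -/
noncomputable def rs (j : ℕ) (t : ℝ) : ℤˣ :=
  if Int.fract ((2 : ℝ) ^ j * t) < 1 / 2 then 1 else -1

lemma sg_rs (j : ℕ) (t : ℝ) : sg (rs j t) = rademacher j t := by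
  unfold rs rademacher
  split_ifs <;> simp [sg]

lemma rs_succ (j : ℕ) (t : ℝ) : rs (j + 1) t = rs j (2 * t) := by
  unfold rs
  rw [pow_succ, mul_assoc]

lemma rs_add_one (j : ℕ) (t : ℝ) : rs j (t + 1) = rs j t := by
  unfold rs
  have : (2:ℝ) ^ j * (t + 1) = 2 ^ j * t + ((2 ^ j : ℕ) : ℝ) := by push_cast; ring
  rw [this, Int.fract_add_natCast]

lemma rs_zero_left (t : ℝ) (h : t ∈ Set.Ioo (0:ℝ) (1/2)) : rs 0 t = 1 := by
  unfold rs
  rw [pow_zero, one_mul, Int.fract_eq_self.mpr ⟨h.1.le, by linarith [h.2]⟩, if_pos h.2]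

lemma rs_zero_right (t : ℝ) (h : t ∈ Set.Ioo (1/2:ℝ) 1) : rs 0 t = -1 := by
  unfold rs
  rw [pow_zero, one_mul, Int.fract_eq_self.mpr ⟨by linarith [h.1], h.2⟩, if_neg (by linarith [h.1])]

lemma rs_integrable {k : ℕ} (G : (Fin k → ℤˣ) → ℝ) (a b : ℝ) :
    IntervalIntegrable (fun t => G (fun j => rs j t)) volume a b := by
  let _ : MeasurableSpace ℤˣ := ⊤
  have hm : Measurable (fun t : ℝ => (fun j : Fin k => rs j t)) := by
    refine measurable_pi_lambda _ fun j => ?_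
    unfold rs
    refine Measurable.ite ?_ measurable_const measurable_const
    exact measurableSet_lt (measurable_fract.comp (measurable_const.mul measurable_id))
      measurable_const
  have hG : Measurable G := measurable_of_countable G
  have hc : Measurable (fun t : ℝ => G (fun j : Fin k => rs j t)) := hG.comp hm
  have hb : ∀ t, ‖G (fun j : Fin k => rs j t)‖ ≤ ∑ e, ‖G e‖ := fun t =>
    Finset.single_le_sum (f := fun e => ‖G e‖) (fun _ _ => norm_nonneg _) (Finset.mem_univ _)
  exact (intervalIntegrable_const (c := ∑ e, ‖G e‖)).mono_fun hc.aestronglyMeasurable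
    (Filter.Eventually.of_forall fun t => (hb t).trans (le_abs_self _))

lemma integral_rs (k : ℕ) (G : (Fin k → ℤˣ) → ℝ) :
    ∫ t in (0:ℝ)..1, G (fun j => rs j t) = 𝔼 e, G e := by
  induction k with
  | zero =>
    have : ∀ t : ℝ, (fun j : Fin 0 => rs j t) = default := fun t => Subsingleton.elim _ _
    simp only [this, Finset.univ_unique, Finset.expect_singleton]
    simp
    congr 1
    exact Subsingleton.elim _ _
  | succ k ih =>
    rw [expect_cons, expect_sign, ← ih, ← ih]
    have hcons : ∀ t, (fun j : Fin (k+1) => rs j t)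
        = Fin.cons (rs 0 t) (fun j : Fin k => rs j (2 * t)) := by
      intro t
      funext j
      refine Fin.cases ?_ (fun i => ?_) j
      · simp
      · simp [rs_succ]
    rw [← intervalIntegral.integral_add_adjacent_intervals (b := 1/2)
      (rs_integrable G _ _) (rs_integrable G _ _)]
    have h1 : ∫ t in (0:ℝ)..(1/2), G (fun j => rs j t)
        = ∫ t in (0:ℝ)..(1/2), (fun s => G (Fin.cons 1 (fun j : Fin k => rs j s))) (2 * t) := by
      refine intervalIntegral.integral_congr_Ioo_of_le (by norm_num) fun t ht => ?_
      simp only [hcons, rs_zero_left t ht]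
    have h2 : ∫ t in (1/2:ℝ)..1, G (fun j => rs j t)
        = ∫ t in (1/2:ℝ)..1, (fun s => G (Fin.cons (-1) (fun j : Fin k => rs j s))) (2 * t) := by
      refine intervalIntegral.integral_congr_Ioo_of_le (by norm_num) fun t ht => ?_
      simp only [hcons, rs_zero_right t ht]
    have h3 : ∫ t in (1:ℝ)..2, G (Fin.cons (-1) (fun j : Fin k => rs j t))
        = ∫ t in (0:ℝ)..1, G (Fin.cons (-1) (fun j : Fin k => rs j t)) := by
      have := intervalIntegral.integral_comp_add_right (a := 0) (b := 1)
        (fun s => G (Fin.cons (-1) (fun j : Fin k => rs j s))) 1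
      simp only [rs_add_one] at this
      rw [this]
      norm_num
    have h2ne : (2:ℝ) ≠ 0 := two_ne_zero
    rw [h1, h2, intervalIntegral.integral_comp_mul_left
        (fun s => G (Fin.cons 1 (fun j : Fin k => rs j s))) h2ne,
      intervalIntegral.integral_comp_mul_left
        (fun s => G (Fin.cons (-1) (fun j : Fin k => rs j s))) h2ne]
    have e1 : (2:ℝ) * 0 = 0 := by norm_num
    have e2 : (2:ℝ) * (1/2) = 1 := by norm_num
    have e3 : (2:ℝ) * 1 = 2 := by norm_num
    rw [e1, e2, e3, h3]
    simp only [smul_eq_mul]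
    ring

lemma expect_le_radNorm {F : Type*} [NormedAddCommGroup F] [NormedSpace ℝ F] {k : ℕ}
    (y : Fin k → F) : 𝔼 e : Fin k → ℤˣ, ‖ssum y e‖ ≤ radNorm y := by
  have h : radNorm y = Real.sqrt (𝔼 e : Fin k → ℤˣ, ‖ssum y e‖ ^ 2) := by
    unfold radNorm
    rw [← integral_rs k (fun e => ‖ssum y e‖ ^ 2), Real.sqrt_eq_rpow]
    simp only [ssum, sg_rs]
  rw [h]
  apply Real.le_sqrt_of_sq_le
  have := Finset.expect_mul_sq_le_sq_mul_sq (Finset.univ : Finset (Fin k → ℤˣ))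
    (fun e => ‖ssum y e‖) (fun _ => (1:ℝ))
  simpa [Finset.expect_const] using this

end Rad

/-! ### The final argument -/

section Final

open scoped BigOperators

lemma weakNorm_le_of {E : Type*} [NormedAddCommGroup E] [NormedSpace ℝ E]
    {p : ℝ} (hp : 1 < p) {k : ℕ} (z : Fin k → E) {b : ℝ} (hb : 0 ≤ b)
    (h : ∀ ψ : E →L[ℝ] ℝ, ‖ψ‖ ≤ 1 → ∑ j, |ψ (z j)| ^ p ≤ b ^ p) : weakNorm p z ≤ b := by
  unfold weakNorm
  refine Real.sSup_le ?_ hb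
  rintro s ⟨ψ, hψ, rfl⟩
  have h0 : 0 ≤ ∑ j, |ψ (z j)| ^ p :=
    Finset.sum_nonneg fun j _ => Real.rpow_nonneg (abs_nonneg _) _
  calc (∑ j, |ψ (z j)| ^ p) ^ (1 / p) ≤ (b ^ p) ^ (1 / p) :=
        Real.rpow_le_rpow h0 (h ψ hψ) (by positivity)
    _ = b := by rw [← Real.rpow_mul hb, mul_one_div_cancel (by linarith), Real.rpow_one]

lemma weakNorm_nonneg' {E : Type*} [NormedAddCommGroup E] [NormedSpace ℝ E]
    (p : ℝ) {k : ℕ} (z : Fin k → E) : 0 ≤ weakNorm p z := by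
  unfold weakNorm
  refine Real.sSup_nonneg ?_
  rintro s ⟨ψ, hψ, rfl⟩
  exact Real.rpow_nonneg (Finset.sum_nonneg fun j _ => Real.rpow_nonneg (abs_nonneg _) _) _

/-- The frozen definition `AlmostSummingAt` elaborates its exponent `r` as a natural number;
this lemma is stated (and proved) for an arbitrary real exponent `r > 0`. -/
lemma not_almost {E : Type*} [NormedAddCommGroup E] [NormedSpace ℝ E]
    (S : Submodule ℝ E) (hS : ¬ FiniteDimensional ℝ S) {p : ℝ} (hp : 1 < p) (f : E → E) (a : E)
    (hf : ∀ x ∈ S, f (a + x) - f a = x) :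
    ¬ ∃ C : ℝ, 0 < C ∧ ∃ ε : ℝ, 0 < ε ∧ ∃ r : ℝ, 0 < r ∧ ∀ (k : ℕ) (x : Fin k → E),
      weakNorm p x < ε →
        radNorm (fun j => f (a + x j) - f a) ≤ C * weakNorm p x ^ r := by
  rintro ⟨C, hC, ε, hε, r, hr, H⟩
  have hK0 : 0 < C * ε ^ r := by positivity
  set K := C * ε ^ r with hK
  set A : ℝ := (10 * (2 * K / ε) ^ p) ^ (1 / (p - 1)) with hAdef
  have hA0 : 0 < A := by positivity
  have hp1 : 0 < p - 1 := by linarith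
  have hAp : A ^ (p - 1) = 10 * (2 * K / ε) ^ p := by
    rw [hAdef, ← Real.rpow_mul (by positivity), one_div_mul_cancel hp1.ne', Real.rpow_one]
  have hA : ∀ (k : ℕ) (y : Fin k → S) (M W : ℝ), 0 < M → (∀ s, ‖y s‖ ≤ M) →
      (∀ φ : S →L[ℝ] ℝ, ‖φ‖ ≤ 1 → ∑ s, |φ (y s)| ≤ W) →
      𝔼 e : Fin k → ℤˣ, ‖ssum y e‖ ≤ A * M + W / 10 := by
    intro k y M W hM hy hW
    have hW0 : 0 ≤ W := by
      have := hW 0 (ContinuousLinearMap.opNorm_le_bound _ zero_le_one fun x => by simp)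
      simpa using this
    have hD : 0 < A * M + W / 10 := by positivity
    set D := A * M + W / 10 with hDdef
    set c := K / D with hc
    have hc0 : 0 < c := by positivity
    set z : Fin k → E := fun s => c • (y s : E) with hz
    have hmain : c ^ p * (M ^ (p - 1) * W) ≤ (ε / 2) ^ p := by
      have h1 : (A * M) ^ (p - 1) * (W / 10) ≤ D ^ p := by
        have : D ^ p = D ^ (p - 1) * D := by
          rw [← Real.rpow_add_one hD.ne', sub_add_cancel]
        rw [this]
        have hAM : 0 < A * M := by positivity
        gcongr
        · rw [hDdef]; linarith [div_nonneg hW0 (by norm_num : (0:ℝ) ≤ 10)]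
        · rw [hDdef]; linarith
      rw [Real.mul_rpow hA0.le hM.le, hAp] at h1
      have h2 : (2 * K / ε) ^ p = K ^ p / (ε / 2) ^ p := by
        rw [← Real.div_rpow hK0.le (by positivity)]
        congr 1
        field_simp
      rw [h2] at h1
      have hep : 0 < (ε / 2) ^ p := by positivity
      have hDp : 0 < D ^ p := by positivity
      rw [hc, Real.div_rpow hK0.le hD.le, div_mul_eq_mul_div, div_le_iff₀ hDp]
      have h3 : 10 * (K ^ p / (ε / 2) ^ p) * M ^ (p - 1) * (W / 10)
          = K ^ p * (M ^ (p - 1) * W) / (ε / 2) ^ p := by ring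
      rw [h3, div_le_iff₀ hep] at h1
      linarith
    have hw : weakNorm p z ≤ ε / 2 := by
      refine weakNorm_le_of hp z (by positivity) fun ψ hψ => ?_
      have hψ' : ‖ψ.comp S.subtypeL‖ ≤ 1 := by
        refine ContinuousLinearMap.opNorm_le_bound _ zero_le_one fun x => ?_
        exact (ψ.le_opNorm _).trans (mul_le_mul_of_nonneg_right hψ (norm_nonneg _))
      have hsum := hW _ hψ'
      have hterm : ∀ j, |ψ (z j)| ^ p ≤ c ^ p * M ^ (p - 1) * |ψ.comp S.subtypeL (y j)| := by
        intro j
        have e1 : ψ (z j) = c * ψ (y j : E) := by simp [hz]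
        have e2 : ψ.comp S.subtypeL (y j) = ψ (y j : E) := rfl
        rw [e1, e2, abs_mul, abs_of_pos hc0, Real.mul_rpow hc0.le (abs_nonneg _), mul_assoc]
        have e3 : |ψ (y j : E)| ^ p = |ψ (y j : E)| ^ (p - 1) * |ψ (y j : E)| := by
          rw [← Real.rpow_add_one' (abs_nonneg _) (by linarith), sub_add_cancel]
        have e4 : |ψ (y j : E)| ≤ M := by
          have := (ψ.le_opNorm (y j : E)).trans
            (mul_le_mul_of_nonneg_right hψ (norm_nonneg _))
          rw [one_mul] at this
          exact this.trans (hy j)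
        rw [e3]
        gcongr
      calc ∑ j, |ψ (z j)| ^ p
          ≤ ∑ j, c ^ p * M ^ (p - 1) * |ψ.comp S.subtypeL (y j)| :=
            Finset.sum_le_sum fun j _ => hterm j
        _ = c ^ p * M ^ (p - 1) * ∑ j, |ψ.comp S.subtypeL (y j)| := by rw [Finset.mul_sum]
        _ ≤ c ^ p * M ^ (p - 1) * W := by gcongr
        _ = c ^ p * (M ^ (p - 1) * W) := by ring
        _ ≤ _ := hmain
    have hR := H k z (by linarith)
    have hfz : (fun j => f (a + z j) - f a) = z := by
      funext j
      exact hf _ (S.smul_mem _ (y j).2)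
    rw [hfz] at hR
    have hR2 : C * weakNorm p z ^ r ≤ K := by
      rw [hK]
      have := Real.rpow_le_rpow (weakNorm_nonneg' p z) (by linarith : weakNorm p z ≤ ε) hr.le
      gcongr
    have hR3 := (expect_le_radNorm z).trans (hR.trans hR2)
    have hss : ∀ e : Fin k → ℤˣ, ‖ssum z e‖ = c * ‖ssum y e‖ := by
      intro e
      have : ssum z e = c • ((ssum y e : S) : E) := by
        simp only [ssum, hz, Submodule.coe_sum, Submodule.coe_smul, Finset.smul_sum]
        exact Finset.sum_congr rfl fun i _ => smul_comm _ _ _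
      rw [this, norm_smul, Real.norm_of_nonneg hc0.le, Submodule.coe_norm]
    simp only [hss] at hR3
    rw [← Finset.mul_expect, hc, div_mul_eq_mul_div, div_le_iff₀ hD] at hR3
    exact le_of_mul_le_mul_left hR3 hK0
  obtain ⟨μ, hμ⟩ := exists_nat_gt (max 1 (16 * 65537 * A))
  have hμ1 : (1:ℝ) < μ := (le_max_left _ _).trans_lt hμ
  have hμ2 : 16 * 65537 * A < μ := (le_max_right _ _).trans_lt hμ
  have hμ3 : 1 ≤ μ := by exact_mod_cast hμ1.le
  obtain ⟨k, x, hx, hρ⟩ := large hS ((40 * μ ^ 2) ^ 2) (Nat.one_le_pow _ _ (by positivity))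
  have hsq : √(((40 * μ ^ 2) ^ 2 : ℕ) : ℝ) / 5 = 8 * (μ:ℝ) ^ 2 := by
    push_cast
    rw [Real.sqrt_sq (by positivity)]
    ring
  rw [hsq] at hρ
  have := core A hA0 hA x hx μ hμ3 hρ
  linarith

lemma ker_inf {E : Type*} [NormedAddCommGroup E] [NormedSpace ℝ E]
    (hE : ¬ FiniteDimensional ℝ E) (φ : E →L[ℝ] ℝ) :
    ¬ FiniteDimensional ℝ (LinearMap.ker (φ : E →ₗ[ℝ] ℝ)) := by
  intro h
  apply hE
  have h2 : FiniteDimensional ℝ (E ⧸ LinearMap.ker (φ : E →ₗ[ℝ] ℝ)) :=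
    Module.Finite.equiv (LinearMap.quotKerEquivRange (φ : E →ₗ[ℝ] ℝ)).symm
  exact Module.Finite.of_submodule_quotient (LinearMap.ker (φ : E →ₗ[ℝ] ℝ))

lemma second_part {E : Type*} [NormedAddCommGroup E] [NormedSpace ℝ E]
    (hE : ¬ FiniteDimensional ℝ E) {p : ℝ} (hp : 1 < p) (m : ℕ) (φ : E →L[ℝ] ℝ) (hφ : φ ≠ 0) :
    ¬ ∀ a : E, AlmostSummingAt p (fun x => φ x ^ m • x) a := by
  intro h
  obtain ⟨v, hv⟩ : ∃ v, φ v ≠ 0 := by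
    by_contra! hc
    exact hφ (ContinuousLinearMap.ext hc)
  have ha : φ ((φ v)⁻¹ • v) = 1 := by simp [hv]
  refine not_almost _ (ker_inf hE φ) hp (fun x => φ x ^ m • x) ((φ v)⁻¹ • v) ?_ ?_
  swap
  · obtain ⟨C, hC, ε, hε, r, hr, H⟩ := h ((φ v)⁻¹ • v)
    refine ⟨C, hC, ε, hε, (r : ℝ), by exact_mod_cast hr, fun k x hx => ?_⟩
    rw [Real.rpow_natCast]
    exact H k x hx
  intro x hx
  have hx0 : φ x = 0 := hx
  simp only [map_add, ha, hx0, add_zero, one_pow, one_smul, add_sub_cancel_left]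

end Final

theorem stmt11 {E : Type*} [NormedAddCommGroup E] [NormedSpace ℝ E] [CompleteSpace E]
    (hE : ¬ FiniteDimensional ℝ E)
    (p : ℝ) (hp : 1 < p) (n : ℕ) (hn : 1 ≤ n) :
    (∃ P : ContinuousMultilinearMap ℝ (fun _ : Fin n => E) E,
        ¬ ∀ a : E, AlmostSummingAt p (fun x => P fun _ => x) a) ∧
      ∀ φ : E →L[ℝ] ℝ, φ ≠ 0 →
        ¬ ∀ a : E, AlmostSummingAt p (fun x => φ x ^ (n - 1) • x) a := by
  refine ⟨?_, fun φ hφ => second_part hE hp (n - 1) φ hφ⟩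
  obtain ⟨m, rfl⟩ : ∃ m, n = m + 1 := ⟨n - 1, by omega⟩
  obtain ⟨φ, hφ⟩ : ∃ φ : E →L[ℝ] ℝ, φ ≠ 0 := by
    obtain ⟨v, hv⟩ : ∃ v : E, v ≠ 0 := by
      by_contra! hc
      have : Subsingleton E := ⟨fun a b => by rw [hc a, hc b]⟩
      exact hE inferInstance
    obtain ⟨g, -, hg⟩ := exists_dual_vector ℝ v (norm_ne_zero_iff.mpr hv)
    refine ⟨g, fun h0 => hv ?_⟩
    rw [h0] at hg
    simpa using hg.symm
  refine ⟨((ContinuousMultilinearMap.smulRightL ℝ (fun _ : Fin m => E) E)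
    ((ContinuousMultilinearMap.mkPiAlgebra ℝ (Fin m) ℝ).compContinuousLinearMap
      fun _ => φ)).uncurryLeft, ?_⟩
  have hP : (fun x : E => (((ContinuousMultilinearMap.smulRightL ℝ (fun _ : Fin m => E) E)
    ((ContinuousMultilinearMap.mkPiAlgebra ℝ (Fin m) ℝ).compContinuousLinearMap
      fun _ => φ)).uncurryLeft : ContinuousMultilinearMap ℝ (fun _ : Fin (m + 1) => E) E)
        fun _ => x) = fun x => φ x ^ m • x := by
    funext x
    rw [ContinuousLinearMap.uncurryLeft_apply]
    simp [Fin.tail_def]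
  rw [hP]
  exact second_part hE hp m φ hφ
end

section
/- Let E be an L_∞ space, n ≥ 2, and F any Banach space. Then every continuous n-linear mapping T : E × ... × E → F is almost 2-summing, i.e., there exists C with (∫_0^1 ‖Σ_{j=1}^k T(x_j^{(1)},...,x_j^{(n)}) r_j(t)‖² dt)^{1/2} ≤ C ∏_{l=1}^n ‖(x_j^{(l)})_{j=1}^k‖_{w,2} for all k and all finite families in E. -/
open MeasureTheory Filter Finset

/-- `E` is an `L_{∞,λ}` space: every finite-dimensional subspace is contained in a
finite-dimensional subspace λ-isomorphic to some `ℓ_∞^m`. -/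
def IsLinftySpace (lam : ℝ) (E : Type*) [NormedAddCommGroup E] [NormedSpace ℝ E] : Prop :=
  ∀ G : Subspace ℝ E, FiniteDimensional ℝ G →
    ∃ H : Subspace ℝ E, G ≤ H ∧ FiniteDimensional ℝ H ∧
      ∃ m : ℕ, ∃ e : H ≃L[ℝ] (Fin m → ℝ),
        ‖(e : H →L[ℝ] (Fin m → ℝ))‖ * ‖(e.symm : (Fin m → ℝ) →L[ℝ] H)‖ ≤ lam

namespace Perez

lemma sup_half {α : Type} (f : α → ℝ) (C B : ℝ) (hB : ∀ a, f a ≤ B)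
    (h : ∀ a G, (∀ b, f b ≤ G) → f a ≤ C + G / 2) (a : α) : f a ≤ 2 * C := by
  have : Nonempty α := ⟨a⟩
  have hbdd : BddAbove (Set.range f) := ⟨B, by rintro _ ⟨b, rfl⟩; exact hB b⟩
  have h1 : ∀ b, f b ≤ ⨆ b, f b := fun b => le_ciSup hbdd b
  have h2 : (⨆ b, f b) ≤ C + (⨆ b, f b) / 2 := ciSup_le fun b => h b _ h1
  linarith [h1 a]

lemma exists_signs (k : ℕ) : ∃ (N : ℕ) (δ : Fin N → Fin k → ℝ), 0 < N ∧
    (∀ ω j, δ ω j ^ 2 = 1) ∧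
    (∀ a : Fin k → ℝ, ∑ ω, (∑ j, δ ω j * a j) ^ 2 = N * ∑ j, a j ^ 2) ∧
    (∀ a : Fin k → ℝ, ∑ ω, (∑ j, δ ω j * a j) ^ 4 ≤ 3 * N * (∑ j, a j ^ 2) ^ 2) := by
  induction k with
  | zero => exact ⟨1, fun _ _ => 1, by simp⟩
  | succ k ih =>
    obtain ⟨N, δ, hN, h1, h2, h4⟩ := ih
    refine ⟨N + N, Fin.append (fun ω => Fin.cons 1 (δ ω)) (fun ω => Fin.cons (-1) (δ ω)),
      by omega, ?_, ?_, ?_⟩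
    · intro ω j
      refine Fin.addCases (fun i => ?_) (fun i => ?_) ω <;>
      refine Fin.cases ?_ (fun l => ?_) j <;>
      simp only [Fin.append_left, Fin.append_right, Fin.cons_zero, Fin.cons_succ, h1] <;> norm_num
    · intro a
      simp only [Fin.sum_univ_add, Fin.append_left, Fin.append_right, Fin.sum_univ_succ,
        Fin.cons_zero, Fin.cons_succ]
      rw [← Finset.sum_add_distrib]
      have := h2 (fun j => a j.succ)
      have e : ∀ ω, (1 * a 0 + ∑ j, δ ω j * a j.succ) ^ 2 + (-1 * a 0 + ∑ j, δ ω j * a j.succ) ^ 2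
        = 2 * a 0 ^ 2 + 2 * (∑ j, δ ω j * a j.succ) ^ 2 := fun ω => by ring
      simp only [e, Finset.sum_add_distrib, ← Finset.mul_sum, this]
      simp
      ring
    · intro a
      simp only [Fin.sum_univ_add, Fin.append_left, Fin.append_right, Fin.sum_univ_succ,
        Fin.cons_zero, Fin.cons_succ]
      rw [← Finset.sum_add_distrib]
      have t2 := h2 (fun j => a j.succ)
      have t4 := h4 (fun j => a j.succ)
      have e : ∀ ω, (1 * a 0 + ∑ j, δ ω j * a j.succ) ^ 4 + (-1 * a 0 + ∑ j, δ ω j * a j.succ) ^ 4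
        = 2 * a 0 ^ 4 + 12 * a 0 ^ 2 * (∑ j, δ ω j * a j.succ) ^ 2
          + 2 * (∑ j, δ ω j * a j.succ) ^ 4 := fun ω => by ring
      simp only [e, Finset.sum_add_distrib, ← Finset.mul_sum, t2]
      simp
      have : (0:ℝ) ≤ N * a 0 ^ 4 := by positivity
      nlinarith

/-- truncation -/
noncomputable def tr (t : ℝ) : ℝ := if |t| ≤ 7 then t else 0

lemma tr_abs (t : ℝ) : |tr t| ≤ 7 := by
  unfold tr; split_ifs with h
  · exact h
  · simp

lemma tr_sq (t : ℝ) : tr t ^ 2 ≤ t ^ 2 := by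
  unfold tr; split_ifs with h
  · exact le_rfl
  · simpa using sq_nonneg t

lemma tr_err (t : ℝ) : (t - tr t) ^ 2 ≤ t ^ 4 / 49 := by
  unfold tr; split_ifs with h
  · simp; positivity
  · have : 49 ≤ t ^ 2 := by
      rw [← sq_abs]; push Not at h; nlinarith
    rw [sub_zero]
    nlinarith [sq_nonneg t]

lemma orth {N k : ℕ} {δ : Fin N → Fin k → ℝ}
    (h2 : ∀ a : Fin k → ℝ, ∑ ω, (∑ j, δ ω j * a j) ^ 2 = N * ∑ j, a j ^ 2)
    (a b : Fin k → ℝ) :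
    ∑ ω, (∑ j, δ ω j * a j) * (∑ j, δ ω j * b j) = N * ∑ j, a j * b j := by
  have h := h2 (fun j => a j + b j)
  have ha := h2 a
  have hb := h2 b
  simp only [mul_add, Finset.sum_add_distrib, add_sq] at h
  have e1 : ∀ ω, 2 * (∑ j, δ ω j * a j) * (∑ j, δ ω j * b j)
    = 2 * ((∑ j, δ ω j * a j) * (∑ j, δ ω j * b j)) := fun ω => by ring
  have e2 : ∀ j, 2 * a j * b j = 2 * (a j * b j) := fun ω => by ring
  simp only [e1, e2, ← Finset.mul_sum] at h
  linarith

lemma orth' {N k : ℕ} {δ : Fin N → Fin k → ℝ}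
    (h2 : ∀ a : Fin k → ℝ, ∑ ω, (∑ j, δ ω j * a j) ^ 2 = N * ∑ j, a j ^ 2)
    (a : Fin k → ℝ) (i : Fin k) :
    ∑ ω, δ ω i * (∑ j, δ ω j * a j) = N * a i := by
  have := orth h2 (Pi.single i 1) a
  simpa [Pi.single_apply] using this

lemma bessel {N k : ℕ} (hN : 0 < N) {δ : Fin N → Fin k → ℝ}
    (h2 : ∀ a : Fin k → ℝ, ∑ ω, (∑ j, δ ω j * a j) ^ 2 = N * ∑ j, a j ^ 2)
    (f : Fin N → ℝ) :
    ∑ j, ((N:ℝ)⁻¹ * ∑ ω, δ ω j * f ω) ^ 2 ≤ (N:ℝ)⁻¹ * ∑ ω, f ω ^ 2 := by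
  set c : Fin k → ℝ := fun j => (N:ℝ)⁻¹ * ∑ ω, δ ω j * f ω with hc
  have hN' : (0:ℝ) < N := by exact_mod_cast hN
  have h : 0 ≤ ∑ ω, (f ω - ∑ j, δ ω j * c j) ^ 2 := Finset.sum_nonneg fun _ _ => sq_nonneg _
  have e : ∑ ω, f ω * (∑ j, δ ω j * c j) = N * ∑ j, c j ^ 2 := by
    simp only [Finset.mul_sum]
    rw [Finset.sum_comm]
    refine Finset.sum_congr rfl fun j _ => ?_
    have : ∑ ω, δ ω j * f ω = N * c j := by rw [hc]; field_simp
    rw [sq, ← mul_assoc, ← this, Finset.sum_mul]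
    exact Finset.sum_congr rfl fun _ _ => by ring
  have e2 : ∀ ω, (f ω - ∑ j, δ ω j * c j) ^ 2 = f ω ^ 2 - 2 * (f ω * ∑ j, δ ω j * c j)
    + (∑ j, δ ω j * c j) ^ 2 := fun _ => by ring
  simp only [e2, Finset.sum_add_distrib, Finset.sum_sub_distrib, ← Finset.mul_sum, e, h2] at h
  rw [le_inv_mul_iff₀ hN']
  linarith

lemma err_sum {N k : ℕ} (hN : 0 < N) {δ : Fin N → Fin k → ℝ}
    (h4 : ∀ a : Fin k → ℝ, ∑ ω, (∑ j, δ ω j * a j) ^ 4 ≤ 3 * N * (∑ j, a j ^ 2) ^ 2)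
    (a : Fin k → ℝ) (ha : ∑ j, a j ^ 2 ≤ 1) :
    (N:ℝ)⁻¹ * ∑ ω, ((∑ j, δ ω j * a j) - tr (∑ j, δ ω j * a j)) ^ 2 ≤ (1 / 4) ^ 2 := by
  have hN' : (0:ℝ) < N := by exact_mod_cast hN
  rw [inv_mul_le_iff₀ hN']
  have h0 : 0 ≤ ∑ j, a j ^ 2 := Finset.sum_nonneg fun _ _ => sq_nonneg _
  have h1 : (∑ j, a j ^ 2) ^ 2 ≤ 1 := pow_le_one₀ h0 ha
  calc _ ≤ ∑ ω, (∑ j, δ ω j * a j) ^ 4 / 49 := Finset.sum_le_sum fun _ _ => tr_err _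
    _ = (∑ ω, (∑ j, δ ω j * a j) ^ 4) / 49 := by rw [Finset.sum_div]
    _ ≤ 3 * N * 1 / 49 := by
        have := h4 a
        have : 3 * (N:ℝ) * (∑ j, a j ^ 2) ^ 2 ≤ 3 * N * 1 := by gcongr
        linarith
    _ ≤ _ := by linarith

/-- `P n C`: the coordinate form of Perez's theorem. -/
def P (n : ℕ) (C : ℝ) : Prop :=
  ∀ (m : ℕ) (φ : MultilinearMap ℝ (fun _ : Fin n => Fin m → ℝ) ℝ) (D : ℝ),
    (∀ u : Fin n → Fin m → ℝ, (∀ i s, |u i s| ≤ 1) → |φ u| ≤ D) →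
    ∀ (k : ℕ) (x : Fin n → Fin k → Fin m → ℝ), (∀ i s, ∑ j, (x i j s) ^ 2 ≤ 1) →
    |∑ j, φ (fun i => x i j)| ≤ C * D

lemma abs_le_one_of_sum {k : ℕ} {a : Fin k → ℝ} (h : ∑ j, a j ^ 2 ≤ 1) (j : Fin k) :
    |a j| ≤ 1 := by
  rw [abs_le_one_iff_mul_self_le_one, ← sq]
  exact (Finset.single_le_sum (f := fun j => a j ^ 2) (fun _ _ => sq_nonneg _)
    (Finset.mem_univ j)).trans h

lemma step {n : ℕ} (hn : 1 ≤ n) {C : ℝ} (hP : P n C) : P (n + 1) (2 * (7 * C)) := by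
  intro m φ D hφ k x hx
  -- linear functional in the first slot
  let L : (Fin k → Fin m → ℝ) → ℝ := fun y => ∑ j, φ.curryLeft (y j) (fun i => x i.succ j)
  have Ladd : ∀ y z, L (y + z) = L y + L z := fun y z => by
    simp [L, Finset.sum_add_distrib, -MultilinearMap.curryLeft_apply]
  have Lsmul : ∀ (c : ℝ) y, L (c • y) = c * L y := fun c y => by
    simp [L, Finset.mul_sum, -MultilinearMap.curryLeft_apply]
  have key : ∀ y : {y : Fin k → Fin m → ℝ // ∀ s, ∑ j, (y j s) ^ 2 ≤ 1},
      |L y.1| ≤ 2 * (7 * C * D) := by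
    intro y
    refine sup_half (α := {y : Fin k → Fin m → ℝ // ∀ s, ∑ j, (y j s) ^ 2 ≤ 1})
      (fun y => |L y.1|) (7 * C * D) (k * D) ?_ ?_ y
    · rintro ⟨y, hy⟩
      refine (Finset.abs_sum_le_sum_abs _ _).trans ?_
      refine (Finset.sum_le_card_nsmul _ _ D fun j _ => ?_).trans (by simp)
      rw [MultilinearMap.curryLeft_apply]
      apply hφ
      intro i s
      refine Fin.cases ?_ (fun i => ?_) i
      · exact abs_le_one_of_sum (hy s) j
      · exact abs_le_one_of_sum (hx i.succ s) j
    · rintro ⟨y, hy⟩ G hG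
      obtain ⟨N, δ, hN, h1, h2, h4⟩ := exists_signs k
      have hN' : (0:ℝ) < N := by exact_mod_cast hN
      let Y : Fin N → Fin m → ℝ := fun ω s => ∑ j, δ ω j * y j s
      let Y1 : Fin N → Fin m → ℝ := fun ω s => tr (Y ω s)
      let y1 : Fin k → Fin m → ℝ := fun j => (N:ℝ)⁻¹ • ∑ ω, δ ω j • Y1 ω
      let y2 : Fin k → Fin m → ℝ := fun j s => (N:ℝ)⁻¹ * ∑ ω, δ ω j * (Y ω s - Y1 ω s)
      have hsum : y = y1 + y2 := by
        funext j s
        simp only [Pi.add_apply, y1, y2, Pi.smul_apply, Finset.sum_apply, smul_eq_mul, mul_sub,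
          Finset.sum_sub_distrib]
        have := orth' h2 (fun j => y j s) j
        simp only [Y, this]
        field_simp
        ring
      have b2 : |L y2| ≤ G / 4 := by
        have := hG ⟨(4:ℝ) • y2, fun s => by
          simp only [Pi.smul_apply, smul_eq_mul, mul_pow, ← Finset.mul_sum]
          have := (bessel hN h2 (fun ω => Y ω s - Y1 ω s)).trans
            (err_sum hN h4 (fun j => y j s) (hy s))
          simp only [y2]
          linarith⟩
        simp only [Lsmul, abs_mul] at this
        rw [abs_of_pos (by norm_num : (0:ℝ) < 4)] at this
        linarith
      have hb : ∀ ω, |∑ j, δ ω j * φ.curryLeft (Y1 ω) (fun i => x i.succ j)| ≤ C * (7 * D) := by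
        intro ω
        let i0 : Fin n := ⟨0, hn⟩
        have := hP m (φ.curryLeft (Y1 ω)) (7 * D) ?_ k
          (fun i j => (if i = i0 then δ ω j else 1) • x i.succ j) ?_
        · convert this using 3 with j
          rw [MultilinearMap.map_smul_univ]
          simp
        · intro u hu
          have : φ.curryLeft (Y1 ω) u = 7 * φ (Fin.cons ((7:ℝ)⁻¹ • Y1 ω) u) := by
            rw [← MultilinearMap.curryLeft_apply, map_smul]
            simp
          rw [this, abs_mul, abs_of_pos (by norm_num : (0:ℝ) < 7)]
          gcongr
          apply hφ
          intro i s
          refine Fin.cases ?_ (fun i => ?_) i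
          · simp only [Fin.cons_zero, Pi.smul_apply, smul_eq_mul, abs_mul]
            have := tr_abs (Y ω s)
            rw [abs_of_pos (by norm_num : (0:ℝ) < 7⁻¹)]
            simp only [Y1]
            linarith
          · exact hu i s
        · intro i s
          refine le_trans (le_of_eq ?_) (hx i.succ s)
          refine Finset.sum_congr rfl fun j _ => ?_
          split_ifs <;> simp [mul_pow, h1]
      have b1 : |L y1| ≤ 7 * C * D := by
        have e : L y1 = (N:ℝ)⁻¹ * ∑ ω, ∑ j, δ ω j * φ.curryLeft (Y1 ω) (fun i => x i.succ j) := by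
          rw [Finset.sum_comm, Finset.mul_sum]
          refine Finset.sum_congr rfl fun j _ => ?_
          simp only [y1, map_smul, map_sum, smul_apply, _root_.sum_apply,
            smul_eq_mul]
        rw [e, abs_mul, abs_of_pos (inv_pos.2 hN'), inv_mul_le_iff₀ hN']
        refine (Finset.abs_sum_le_sum_abs _ _).trans ?_
        refine (Finset.sum_le_card_nsmul _ _ _ fun ω _ => hb ω).trans (le_of_eq ?_)
        simp only [Finset.card_univ, Fintype.card_fin, nsmul_eq_mul]
        ring
      have hG0 : 0 ≤ G := (abs_nonneg _).trans (hG ⟨y, hy⟩)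
      calc |L y| = |L y1 + L y2| := by rw [← Ladd, ← hsum]
        _ ≤ |L y1| + |L y2| := abs_add_le _ _
        _ ≤ _ := by linarith
  have := key ⟨x 0, hx 0⟩
  calc |∑ j, φ (fun i => x i j)| = |L (x 0)| := by
        congr 1
        refine Finset.sum_congr rfl fun j _ => ?_
        rw [MultilinearMap.curryLeft_apply]
        congr 1
        funext i
        refine Fin.cases ?_ (fun i => ?_) i <;> simp
    _ ≤ _ := this
    _ = _ := by ring


lemma base : P 2 98 := by
  intro m φ D hφ k x hx
  have hD : 0 ≤ D := (abs_nonneg _).trans (hφ 0 (by simp))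
  let B : (Fin m → ℝ) →ₗ[ℝ] (Fin m → ℝ) →ₗ[ℝ] ℝ := LinearMap.mk₂ ℝ (fun u v => φ ![u, v])
    (fun u u' v => by simpa using φ.cons_add ![v] u u')
    (fun c u v => by simpa using φ.cons_smul ![v] c u)
    (fun u v v' => by
      have e : ∀ w : Fin m → ℝ, Function.update ![u, 0] 1 w = ![u, w] := fun w => by
        funext i; fin_cases i <;> rfl
      have := φ.map_update_add ![u, 0] 1 v v'
      rwa [e, e, e] at this)
    (fun c u v => by
      have e : ∀ w : Fin m → ℝ, Function.update ![u, 0] 1 w = ![u, w] := fun w => by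
        funext i; fin_cases i <;> rfl
      have := φ.map_update_smul ![u, 0] 1 c v
      rwa [e, e] at this)
  have hB1 : ∀ u v : Fin m → ℝ, (∀ s, |u s| ≤ 1) → (∀ s, |v s| ≤ 1) → |B u v| ≤ D := by
    intro u v hu hv
    apply hφ
    intro i s
    fin_cases i
    · exact hu s
    · exact hv s
  have hB : ∀ (a b : ℝ) (u v : Fin m → ℝ), 0 ≤ a → 0 ≤ b → (∀ s, |u s| ≤ a) → (∀ s, |v s| ≤ b) →
      |B u v| ≤ a * b * D := by
    intro a b u v ha hb hu hv
    rcases ha.eq_or_lt with rfl | ha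
    · have : u = 0 := by funext s; simpa using hu s
      simp [this]
    rcases hb.eq_or_lt with rfl | hb
    · have : v = 0 := by funext s; simpa using hv s
      simp [this]
    have := hB1 (a⁻¹ • u) (b⁻¹ • v)
      (fun s => by
        simp only [Pi.smul_apply, smul_eq_mul, abs_mul, abs_inv, abs_of_pos ha]
        rw [inv_mul_le_iff₀ ha]; simpa using hu s)
      (fun s => by
        simp only [Pi.smul_apply, smul_eq_mul, abs_mul, abs_inv, abs_of_pos hb]
        rw [inv_mul_le_iff₀ hb]; simpa using hv s)
    simp only [map_smul, LinearMap.smul_apply, smul_eq_mul, abs_mul, abs_inv, abs_of_pos ha,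
      abs_of_pos hb] at this
    rw [inv_mul_le_iff₀ hb, inv_mul_le_iff₀ ha] at this
    linarith
  let α := Σ k : ℕ, {p : (Fin k → Fin m → ℝ) × (Fin k → Fin m → ℝ) //
    (∀ s, ∑ j, (p.1 j s) ^ 2 ≤ 1) ∧ (∀ s, ∑ j, (p.2 j s) ^ 2 ≤ 1)}
  have key : ∀ p : α, |∑ j, B (p.2.1.1 j) (p.2.1.2 j)| ≤ 2 * (49 * D) := by
    intro p
    refine sup_half (α := α) (fun p => |∑ j, B (p.2.1.1 j) (p.2.1.2 j)|) (49 * D) (m * D) ?_ ?_ p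
    · rintro ⟨k, ⟨x, y⟩, hx, hy⟩
      have hnx : ∀ (x : Fin k → Fin m → ℝ) (j : Fin k) (s : Fin m),
          |x j s| ≤ √(∑ s, x j s ^ 2) := fun x j s => by
        apply Real.abs_le_sqrt
        exact Finset.single_le_sum (f := fun s => x j s ^ 2) (fun _ _ => sq_nonneg _)
          (Finset.mem_univ s)
      have hsx : ∀ (x : Fin k → Fin m → ℝ), (∀ s, ∑ j, (x j s) ^ 2 ≤ 1) →
          ∑ j, ∑ s, x j s ^ 2 ≤ m := fun x hx => by
        rw [Finset.sum_comm]
        exact (Finset.sum_le_card_nsmul _ _ _ fun s _ => hx s).trans (by simp)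
      refine (Finset.abs_sum_le_sum_abs _ _).trans ?_
      have : ∀ j, |B (x j) (y j)| ≤ (∑ s, x j s ^ 2 + ∑ s, y j s ^ 2) / 2 * D := fun j => by
        refine (hB _ _ _ _ (Real.sqrt_nonneg _) (Real.sqrt_nonneg _) (hnx x j) (hnx y j)).trans ?_
        gcongr
        have h1 := Real.sq_sqrt (Finset.sum_nonneg fun s (_ : s ∈ Finset.univ) => sq_nonneg (x j s))
        have h2 := Real.sq_sqrt (Finset.sum_nonneg fun s (_ : s ∈ Finset.univ) => sq_nonneg (y j s))
        nlinarith [sq_nonneg (√(∑ s, x j s ^ 2) - √(∑ s, y j s ^ 2))]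
      refine (Finset.sum_le_sum fun j _ => this j).trans ?_
      rw [← Finset.sum_mul, ← Finset.sum_div, Finset.sum_add_distrib]
      gcongr
      linarith [hsx x hx, hsx y hy]
    · rintro ⟨k, ⟨x, y⟩, hx, hy⟩ G hG
      simp only at hx hy ⊢
      obtain ⟨N, δ, hN, h1, h2, h4⟩ := exists_signs k
      have hN' : (0:ℝ) < N := by exact_mod_cast hN
      let X : Fin N → Fin m → ℝ := fun ω => ∑ j, δ ω j • x j
      let Y : Fin N → Fin m → ℝ := fun ω => ∑ j, δ ω j • y j
      let X1 : Fin N → Fin m → ℝ := fun ω s => tr (X ω s)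
      let Y1 : Fin N → Fin m → ℝ := fun ω s => tr (Y ω s)
      have Xs : ∀ ω s, X ω s = ∑ j, δ ω j * x j s := fun ω s => by simp [X]
      have Ys : ∀ ω s, Y ω s = ∑ j, δ ω j * y j s := fun ω s => by simp [Y]
      have hmain : ∑ j, B (x j) (y j) = (N:ℝ)⁻¹ * ∑ ω, B (X ω) (Y ω) := by
        rw [eq_inv_mul_iff_mul_eq₀ hN'.ne']
        have : ∀ ω, B (X ω) (Y ω) = ∑ i, ∑ j, (δ ω i * δ ω j) * B (x i) (y j) := fun ω => by
          simp only [X, Y, map_sum, map_smul, LinearMap.sum_apply, LinearMap.smul_apply,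
            smul_eq_mul, Finset.mul_sum]
          rw [Finset.sum_comm]
          refine Finset.sum_congr rfl fun i _ => Finset.sum_congr rfl fun j _ => by ring
        simp only [this]
        rw [Finset.sum_comm, Finset.mul_sum]
        refine Finset.sum_congr rfl fun i _ => ?_
        have := orth' h2 (fun j => B (x i) (y j)) i
        rw [← this]
        refine Finset.sum_congr rfl fun ω _ => ?_
        rw [Finset.mul_sum]
        refine Finset.sum_congr rfl fun j _ => by ring
      -- error estimate
      have herr : ∀ (a b : ℝ) (U V : Fin N → Fin m → ℝ), 0 < a → 0 < b →
          (∀ s, (N:ℝ)⁻¹ * ∑ ω, U ω s ^ 2 ≤ a ^ 2) → (∀ s, (N:ℝ)⁻¹ * ∑ ω, V ω s ^ 2 ≤ b ^ 2) →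
          |(N:ℝ)⁻¹ * ∑ ω, B (U ω) (V ω)| ≤ a * b * G := by
        intro a b U V ha hb hU hV
        have hc : (√(N:ℝ))⁻¹ ^ 2 = (N:ℝ)⁻¹ := by rw [inv_pow, Real.sq_sqrt hN'.le]
        have hh : ∀ (a : ℝ) (U : Fin N → Fin m → ℝ), 0 < a →
            (∀ s, (N:ℝ)⁻¹ * ∑ ω, U ω s ^ 2 ≤ a ^ 2) →
            ∀ s, ∑ ω, (((√(N:ℝ))⁻¹ * a⁻¹) • U ω) s ^ 2 ≤ 1 := by
          intro a U ha hU s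
          simp only [Pi.smul_apply, smul_eq_mul, mul_pow, ← Finset.mul_sum, hc]
          rw [mul_assoc, mul_left_comm, inv_pow, inv_mul_le_iff₀ (by positivity)]
          simpa using hU s
        have := hG ⟨N, ⟨fun ω => ((√(N:ℝ))⁻¹ * a⁻¹) • U ω, fun ω => ((√(N:ℝ))⁻¹ * b⁻¹) • V ω⟩,
          hh a U ha hU, hh b V hb hV⟩
        simp only [map_smul, LinearMap.smul_apply, smul_eq_mul, ← Finset.mul_sum] at this
        have e : (N:ℝ)⁻¹ * ∑ ω, B (U ω) (V ω) = a * b *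
            ((√(N:ℝ))⁻¹ * b⁻¹ * ((√(N:ℝ))⁻¹ * a⁻¹ * ∑ ω, B (U ω) (V ω))) := by
          rw [← hc]; field_simp
        rw [e, abs_mul, abs_of_pos (mul_pos ha hb)]
        gcongr
      have hx2 : ∀ (x : Fin k → Fin m → ℝ), (∀ s, ∑ j, (x j s) ^ 2 ≤ 1) → ∀ s,
          (N:ℝ)⁻¹ * ∑ ω, (∑ j, δ ω j * x j s) ^ 2 ≤ 1 := fun x hx s => by
        rw [h2 (fun j => x j s), inv_mul_cancel_left₀ hN'.ne']
        exact hx s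
      have t1 : |(N:ℝ)⁻¹ * ∑ ω, B (X1 ω) (Y1 ω)| ≤ 49 * D := by
        rw [abs_mul, abs_of_pos (inv_pos.2 hN'), inv_mul_le_iff₀ hN']
        refine (Finset.abs_sum_le_sum_abs _ _).trans ?_
        refine (Finset.sum_le_card_nsmul _ _ (7 * 7 * D) fun ω _ => hB 7 7 _ _ (by norm_num)
          (by norm_num) (fun s => tr_abs _) (fun s => tr_abs _)).trans (le_of_eq ?_)
        simp only [Finset.card_univ, Fintype.card_fin, nsmul_eq_mul]
        ring
      have t2 : |(N:ℝ)⁻¹ * ∑ ω, B (X1 ω) (Y ω - Y1 ω)| ≤ 1 * (1 / 4) * G := by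
        refine herr 1 (1 / 4) _ _ one_pos (by norm_num) (fun s => ?_) (fun s => ?_)
        · refine le_trans ?_ ((hx2 x hx s).trans (by norm_num))
          refine mul_le_mul_of_nonneg_left (Finset.sum_le_sum fun ω _ => ?_) (by positivity)
          rw [← Xs]
          exact tr_sq _
        · simpa only [Pi.sub_apply, Y1, Ys] using err_sum hN h4 (fun j => y j s) (hy s)
      have t3 : |(N:ℝ)⁻¹ * ∑ ω, B (X ω - X1 ω) (Y ω)| ≤ (1 / 4) * 1 * G := by
        refine herr (1 / 4) 1 _ _ (by norm_num) one_pos (fun s => ?_) (fun s => ?_)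
        · simpa only [Pi.sub_apply, X1, Xs] using err_sum hN h4 (fun j => x j s) (hx s)
        · simpa only [Ys, one_pow] using hx2 y hy s
      have hsplit : (N:ℝ)⁻¹ * ∑ ω, B (X ω) (Y ω) = (N:ℝ)⁻¹ * ∑ ω, B (X1 ω) (Y1 ω)
          + (N:ℝ)⁻¹ * ∑ ω, B (X1 ω) (Y ω - Y1 ω) + (N:ℝ)⁻¹ * ∑ ω, B (X ω - X1 ω) (Y ω) := by
        rw [← mul_add, ← mul_add, ← Finset.sum_add_distrib, ← Finset.sum_add_distrib]
        congr 1
        refine Finset.sum_congr rfl fun ω _ => ?_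
        simp only [map_sub, LinearMap.sub_apply]
        ring
      rw [hmain, hsplit]
      refine (abs_add_three _ _ _).trans ?_
      linarith
  have := key ⟨k, ⟨x 0, x 1⟩, hx 0, hx 1⟩
  have e : ∀ j, φ (fun i => x i j) = B (x 0 j) (x 1 j) := fun j => by
    simp only [B, LinearMap.mk₂_apply]
    congr 1
    funext i
    fin_cases i <;> rfl
  simp only [e]
  refine this.trans (le_of_eq (by ring))

lemma exists_P (n : ℕ) : ∃ C, 0 < C ∧ P (n + 2) C := by
  induction n with
  | zero => exact ⟨98, by norm_num, base⟩
  | succ n ih =>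
    obtain ⟨C, hC, h⟩ := ih
    exact ⟨2 * (7 * C), by positivity, step (by omega) h⟩

lemma P_scaled {n : ℕ} {C : ℝ} (hP : P n C) (m : ℕ)
    (φ : MultilinearMap ℝ (fun _ : Fin n => Fin m → ℝ) ℝ) (D : ℝ) (hC : 0 ≤ C)
    (hφ : ∀ u : Fin n → Fin m → ℝ, (∀ i s, |u i s| ≤ 1) → |φ u| ≤ D)
    (k : ℕ) (x : Fin n → Fin k → Fin m → ℝ) (R : Fin n → ℝ) (hR : ∀ i, 0 ≤ R i)
    (hx : ∀ i s, ∑ j, (x i j s) ^ 2 ≤ R i ^ 2) :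
    |∑ j, φ (fun i => x i j)| ≤ C * D * ∏ i, R i := by
  have hD : 0 ≤ D := (abs_nonneg _).trans (hφ 0 (by simp))
  by_cases h : ∃ i, R i = 0
  · obtain ⟨i, hi⟩ := h
    have h0 : ∀ j, x i j = 0 := fun j => by
      funext s
      have h1 := hx i s
      rw [hi] at h1
      have h2 := (Finset.single_le_sum (f := fun j => x i j s ^ 2) (fun _ _ => sq_nonneg _)
        (Finset.mem_univ j)).trans h1
      have h3 : x i j s ^ 2 = 0 := le_antisymm (by simpa using h2) (sq_nonneg _)
      simpa using h3
    have : ∀ j, φ (fun i => x i j) = 0 := fun j => φ.map_coord_zero i (h0 j)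
    simp only [this, Finset.sum_const_zero, abs_zero]
    have : 0 ≤ ∏ i, R i := Finset.prod_nonneg fun i _ => hR i
    positivity
  · push Not at h
    have hpos : ∀ i, 0 < R i := fun i => (hR i).lt_of_ne (h i).symm
    have := hP m φ D hφ k (fun i j => (R i)⁻¹ • x i j) (fun i s => by
      simp only [Pi.smul_apply, smul_eq_mul, mul_pow, ← Finset.mul_sum]
      have := hpos i
      rw [inv_pow, inv_mul_le_iff₀ (by positivity)]
      simpa using hx i s)
    simp only [MultilinearMap.map_smul_univ, smul_eq_mul, ← Finset.mul_sum] at this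
    have hp : 0 < ∏ i, R i := Finset.prod_pos fun i _ => hpos i
    rw [Finset.prod_inv_distrib, abs_mul, abs_inv, abs_of_pos hp, inv_mul_le_iff₀ hp] at this
    linarith

lemma weakNorm_nonneg {E : Type*} [NormedAddCommGroup E] [NormedSpace ℝ E]
    {k : ℕ} (x : Fin k → E) : 0 ≤ weakNorm 2 x := by
  apply Real.sSup_nonneg
  rintro s ⟨φ, -, rfl⟩
  positivity

lemma le_weakNorm {E : Type*} [NormedAddCommGroup E] [NormedSpace ℝ E]
    {k : ℕ} (x : Fin k → E) (φ : E →L[ℝ] ℝ) (a : ℝ) (ha : 0 ≤ a) (hφ : ‖φ‖ ≤ a) :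
    ∑ j, (φ (x j)) ^ 2 ≤ (a * weakNorm 2 x) ^ 2 := by
  have hbdd : BddAbove {s : ℝ | ∃ φ : E →L[ℝ] ℝ, ‖φ‖ ≤ 1 ∧
      s = (∑ j, |φ (x j)| ^ (2:ℝ)) ^ (1 / (2:ℝ))} := by
    refine ⟨(∑ j, ‖x j‖ ^ (2:ℝ)) ^ (1 / (2:ℝ)), ?_⟩
    rintro s ⟨φ, h, rfl⟩
    gcongr with j
    simpa using φ.le_of_opNorm_le h (x j)
  have one : ∀ φ : E →L[ℝ] ℝ, ‖φ‖ ≤ 1 → ∑ j, (φ (x j)) ^ 2 ≤ weakNorm 2 x ^ 2 := by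
    intro φ h
    have := le_csSup hbdd ⟨φ, h, rfl⟩
    change _ ≤ weakNorm 2 x at this
    simp only [Real.rpow_two, sq_abs] at this
    rw [← Real.sqrt_eq_rpow] at this
    exact (Real.sqrt_le_left (weakNorm_nonneg x)).1 this
  rcases ha.eq_or_lt with rfl | ha
  · have : φ = 0 := by simpa using hφ
    simp [this]
  · have := one (a⁻¹ • φ) (by
      rw [norm_smul, norm_inv, Real.norm_of_nonneg ha.le, inv_mul_le_iff₀ ha]; simpa using hφ)
    simp only [smul_apply, smul_eq_mul, mul_pow, ← Finset.mul_sum] at this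
    rw [inv_pow, inv_mul_le_iff₀ (by positivity)] at this
    rw [mul_pow]
    exact this

end Perez

theorem stmt13 {E F : Type*} [NormedAddCommGroup E] [NormedSpace ℝ E]
    [NormedAddCommGroup F] [NormedSpace ℝ F]
    (lam : ℝ) (hlam : 1 ≤ lam) (hE : IsLinftySpace lam E)
    (n : ℕ) (hn : 2 ≤ n)
    (T : ContinuousMultilinearMap ℝ (fun _ : Fin n => E) F) :
    ∃ C > (0:ℝ), ∀ (k : ℕ) (x : Fin n → Fin k → E),
      radNorm (fun j => T fun i => x i j) ≤ C * ∏ i, weakNorm 2 (x i) := by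
  obtain ⟨n', rfl⟩ : ∃ n', n = n' + 2 := ⟨n - 2, by omega⟩
  obtain ⟨C, hC, hP⟩ := Perez.exists_P n'
  refine ⟨C * ((‖T‖ + 1) * lam ^ (n' + 2)), by positivity, ?_⟩
  intro k x
  have hW : 0 ≤ ∏ i, weakNorm 2 (x i) := Finset.prod_nonneg fun i _ => Perez.weakNorm_nonneg _
  set K := C * ((‖T‖ + 1) * lam ^ (n' + 2)) * ∏ i, weakNorm 2 (x i) with hK
  have hK0 : 0 ≤ K := by positivity
  obtain ⟨H, hGH, -, m, e, he⟩ := hE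
    (Submodule.span ℝ (Set.range fun p : Fin (n' + 2) × Fin k => x p.1 p.2))
    (FiniteDimensional.span_of_finite ℝ (Set.finite_range _))
  have hxH : ∀ i j, x i j ∈ H := fun i j => hGH (Submodule.subset_span ⟨(i, j), rfl⟩)
  have hpt : ∀ t : ℝ, ‖∑ j : Fin k, rademacher (j : ℕ) t • T (fun i => x i j)‖ ≤ K := by
    intro t
    obtain ⟨ψ, hψ1, hψ⟩ := exists_dual_vector'' ℝ
      (∑ j : Fin k, rademacher (j : ℕ) t • T (fun i => x i j))
    have hr : ∀ j, rademacher j t ^ 2 = 1 := fun j => by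
      unfold rademacher; split_ifs <;> norm_num
    let S : (Fin m → ℝ) →L[ℝ] E := H.subtypeL.comp (e.symm : (Fin m → ℝ) →L[ℝ] H)
    let φ : MultilinearMap ℝ (fun _ : Fin (n' + 2) => Fin m → ℝ) ℝ :=
      ((ψ : F →ₗ[ℝ] ℝ).compMultilinearMap T.toMultilinearMap).compLinearMap
        (fun _ => (S : (Fin m → ℝ) →ₗ[ℝ] E))
    have hφv : ∀ u, φ u = ψ (T fun i => S (u i)) := fun u => rfl
    set a := ‖(e : H →L[ℝ] (Fin m → ℝ))‖ with ha
    set b := ‖(e.symm : (Fin m → ℝ) →L[ℝ] H)‖ with hb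
    have ha0 : 0 ≤ a := norm_nonneg (e : H →L[ℝ] (Fin m → ℝ))
    have hb0 : 0 ≤ b := norm_nonneg (e.symm : (Fin m → ℝ) →L[ℝ] H)
    have hφ : ∀ u : Fin (n' + 2) → Fin m → ℝ, (∀ i s, |u i s| ≤ 1) →
        |φ u| ≤ (‖T‖ + 1) * b ^ (n' + 2) := by
      intro u hu
      rw [hφv]
      have h1 : |ψ (T fun i => S (u i))| ≤ ‖T fun i => S (u i)‖ := by
        simpa using ψ.le_of_opNorm_le hψ1 (T fun i => S (u i))
      have h2 : ∀ i, ‖S (u i)‖ ≤ b := fun i => by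
        have h3 : ‖u i‖ ≤ 1 := (pi_norm_le_iff_of_nonneg zero_le_one).2 fun s => by
          simpa using hu i s
        have h4 := (e.symm : (Fin m → ℝ) →L[ℝ] H).le_of_opNorm_le_of_le le_rfl h3
        simpa [S] using h4
      refine h1.trans ((T.le_opNorm _).trans ?_)
      have h5 : ∏ i, ‖S (u i)‖ ≤ b ^ (n' + 2) := by
        refine (Finset.prod_le_prod (fun _ _ => norm_nonneg _) fun i _ => h2 i).trans ?_
        simp
      gcongr
      linarith
    let y : Fin (n' + 2) → Fin k → Fin m → ℝ := fun i j =>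
      (if i = 0 then rademacher (j : ℕ) t else 1) • e ⟨x i j, hxH i j⟩
    have hy : ∀ i s, ∑ j, (y i j s) ^ 2 ≤ (a * weakNorm 2 (x i)) ^ 2 := by
      intro i s
      obtain ⟨g, hg, hgn⟩ := exists_extension_norm_eq H
        ((ContinuousLinearMap.proj (R := ℝ) (φ := fun _ : Fin m => ℝ) s).comp
          (e : H →L[ℝ] (Fin m → ℝ)))
      have hga : ‖g‖ ≤ a := by
        rw [hgn]
        refine ContinuousLinearMap.opNorm_le_bound _ ha0 fun z => ?_
        exact (norm_le_pi_norm (e z) s).trans ((e : H →L[ℝ] (Fin m → ℝ)).le_opNorm z)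
      refine le_trans (le_of_eq ?_) (Perez.le_weakNorm (x i) g a ha0 hga)
      refine Finset.sum_congr rfl fun j _ => ?_
      have := hg ⟨x i j, hxH i j⟩
      simp only at this
      rw [this]
      simp only [y]
      split_ifs <;> simp [mul_pow, hr]
    have main := Perez.P_scaled hP m φ _ hC.le hφ k y (fun i => a * weakNorm 2 (x i))
      (fun i => mul_nonneg ha0 (Perez.weakNorm_nonneg _)) hy
    have hsum : ∑ j, φ (fun i => y i j)
        = ψ (∑ j : Fin k, rademacher (j : ℕ) t • T (fun i => x i j)) := by
      rw [map_sum]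
      refine Finset.sum_congr rfl fun j _ => ?_
      simp only [y]
      rw [MultilinearMap.map_smul_univ, hφv]
      simp [S]
    rw [hsum, hψ] at main
    have hmain : ‖∑ j : Fin k, rademacher (j : ℕ) t • T (fun i => x i j)‖ ≤
        C * ((‖T‖ + 1) * b ^ (n' + 2)) * ∏ i, (a * weakNorm 2 (x i)) := by
      simpa using main
    refine hmain.trans ?_
    rw [Finset.prod_mul_distrib]
    simp only [Finset.prod_const, Finset.card_univ, Fintype.card_fin]
    calc _ = C * ((‖T‖ + 1) * (a * b) ^ (n' + 2)) * ∏ i, weakNorm 2 (x i) := by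
          rw [mul_pow]; ring
      _ ≤ K := by
          rw [hK]
          gcongr
  unfold radNorm
  rw [← Real.sqrt_eq_rpow]
  refine Real.sqrt_le_iff.2 ⟨hK0, ?_⟩
  have := intervalIntegral.norm_integral_le_of_norm_le_const (a := (0:ℝ)) (b := 1)
    (f := fun t => ‖∑ j : Fin k, rademacher (j : ℕ) t • T (fun i => x i j)‖ ^ 2) (C := K ^ 2)
    (fun t _ => by
      rw [norm_pow, norm_norm]
      have := hpt t
      gcongr)
  simpa using (le_abs_self _).trans this
end
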